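/- There exist constants a > 0 and n₀ such that the following holds for all n ≥ n₀ divisible by 10⁶. Let D ⊆ [n] with |D| = n/10⁶, let y, z ∈ [n] be distinct, let 𝒫 = (D₁,…,D₆) be an equitable partition of D into six parts, and let H be chosen uniformly at random from 𝒢_D. Then P[ r_{(y,z,𝒫)}(H) ≤ n²/10⁵⁰ | H ∈ Q̂_D^{(y,z,𝒫)} ] ≤ exp(−a·n²). -/

import Mathlib

open scoped Classical

noncomputable section

namespace RandomLatin

/-- `φ` is a proper `n`-arc-colouring of the complete digraph with loops on `Fin n`:
`φ i j` is the colour of the arc `i → j`, and no two arcs of the same colour share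
a common tail or a common head. -/
def IsProper {n : ℕ} (φ : Fin n → Fin n → Fin n) : Prop :=
  (∀ i j j' : Fin n, φ i j = φ i j' → j = j') ∧
  (∀ i i' j : Fin n, φ i j = φ i' j → i = i')

/-- The set `Φ(K_n^↔)` of proper `n`-arc-colourings of the complete digraph with loops. -/
abbrev Colouring (n : ℕ) : Type := {φ : Fin n → Fin n → Fin n // IsProper φ}

/-- `L` is an `n × n` Latin square with symbols `Fin n`. -/
def IsLatin {n : ℕ} (L : Fin n → Fin n → Fin n) : Prop :=
  (∀ i, Function.Bijective (L i)) ∧ (∀ j, Function.Bijective fun i => L i j)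

abbrev LatinSquare (n : ℕ) : Type := {L : Fin n → Fin n → Fin n // IsLatin L}

/-- The set of positions `{(i, σ i) : i}` is a (full) transversal of `L`. -/
def IsTransversal {n : ℕ} (L : Fin n → Fin n → Fin n) (σ : Equiv.Perm (Fin n)) : Prop :=
  Function.Bijective fun i => L i (σ i)

/-- A transversal is Hamilton if its arc set `{i → σ i}` is a directed Hamilton cycle. -/
def IsHamiltonTransversal {n : ℕ} (L : Fin n → Fin n → Fin n) (σ : Equiv.Perm (Fin n)) :
    Prop :=
  IsTransversal L σ ∧ σ.IsCycle ∧ σ.support = Finset.univ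

def hamTransversalCount {n : ℕ} (L : Fin n → Fin n → Fin n) : ℕ :=
  Nat.card {σ : Equiv.Perm (Fin n) // IsHamiltonTransversal L σ}

/-- The number of rainbow directed Hamilton cycles of a coloured `K_n^↔`. -/
def rainbowHamCycleCount {n : ℕ} (φ : Fin n → Fin n → Fin n) : ℕ :=
  Nat.card {σ : Equiv.Perm (Fin n) //
    Function.Injective (fun i => φ i (σ i)) ∧ σ.IsCycle ∧ σ.support = Finset.univ}

/-- The maximum number of appearances of a symbol on the leading diagonal. -/
def diagMax {n : ℕ} (L : Fin n → Fin n → Fin n) : ℕ :=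
  Finset.univ.sup fun s : Fin n => (Finset.univ.filter fun i : Fin n => L i i = s).card

/-! ### The spaces `𝒢_D` -/

/-- `𝒢_D`: proper arc-colourings, with colour set `D`, of spanning subdigraphs of `K_n^↔`
in which every vertex has in- and out-degree `|D|`.  `f d i` is the head of the unique
`d`-coloured arc with tail `i`. -/
def GD (n : ℕ) (D : Finset (Fin n)) : Type :=
  {f : {d : Fin n // d ∈ D} → Fin n → Fin n //
    (∀ d, Function.Bijective (f d)) ∧ ∀ i : Fin n, Function.Injective fun d => f d i}

/-- `comp H`: the number of completions of `H ∈ 𝒢_D` to an element of `Φ(K_n^↔)`,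
i.e. the number of `g ∈ 𝒢_{Dᶜ}` whose arc set is disjoint from that of `H`. -/
def completionCount {n : ℕ} {D : Finset (Fin n)} (H : GD n D) : ℕ :=
  Nat.card {g : GD n Dᶜ //
    ∀ (d : {d : Fin n // d ∈ D}) (d' : {d : Fin n // d ∈ Dᶜ}) (i : Fin n),
      H.1 d i ≠ g.1 d' i}

/-- `e_H(A₁, A₂)`: the number of arcs of `H` with tail in `A₁` and head in `A₂`. -/
def eArcs {n : ℕ} {D : Finset (Fin n)} (H : GD n D) (A₁ A₂ : Finset (Fin n)) : ℕ :=
  Nat.card {p : {d : Fin n // d ∈ D} × Fin n // p.2 ∈ A₁ ∧ H.1 p.1 p.2 ∈ A₂}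

/-! ### Absorbing gadgets -/

/-- A `(v,c)`-absorbing gadget, recorded by its vertices `x 0 = x₁, …, x 5 = x₆`. -/
def IsAbsGadget {n : ℕ} (φ : Fin n → Fin n → Fin n) (v c : Fin n) (x : Fin 6 → Fin n) :
    Prop :=
  ([v, x 0, x 1, x 2, x 3, x 4, x 5] : List (Fin n)).Nodup ∧
  φ (x 0) v = φ (x 3) (x 5) ∧
  φ v (x 1) = φ (x 2) (x 4) ∧
  φ (x 0) (x 1) = φ (x 2) (x 3) ∧
  φ (x 4) (x 5) = c ∧
  ([φ (x 0) v, φ v (x 1), φ (x 0) (x 1), c] : List (Fin n)).Nodup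

def absGadgetVerts {n : ℕ} (v : Fin n) (x : Fin 6 → Fin n) : Finset (Fin n) :=
  insert v (Finset.image x Finset.univ)

/-- The gadget contains an arc of colour `d`. -/
def absGadgetHasColour {n : ℕ} (φ : Fin n → Fin n → Fin n) (v : Fin n)
    (x : Fin 6 → Fin n) (d : Fin n) : Prop :=
  d = φ (x 0) v ∨ d = φ v (x 1) ∨ d = φ (x 0) (x 1) ∨ d = φ (x 2) (x 3) ∨
  d = φ (x 2) (x 4) ∨ d = φ (x 3) (x 5) ∨ d = φ (x 4) (x 5)

def WellSpreadAbsGadgets {n : ℕ} (φ : Fin n → Fin n → Fin n) (v c : Fin n)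
    (𝒜 : Finset (Fin 6 → Fin n)) : Prop :=
  (∀ u : Fin n, u ≠ v → (𝒜.filter fun x => u ∈ absGadgetVerts v x).card ≤ n) ∧
  (∀ d : Fin n, d ≠ c → (𝒜.filter fun x => absGadgetHasColour φ v x d).card ≤ n)

/-! ### Bridging gadgets (with respect to a full colouring) -/

/-- A `(y,z)`-bridging gadget, recorded by its vertices `w 0 = w₁, …, w 5 = w₆`. -/
def IsBridgeGadget {n : ℕ} (φ : Fin n → Fin n → Fin n) (y z : Fin n)
    (w : Fin 6 → Fin n) : Prop :=
  ([y, z, w 0, w 1, w 2, w 3, w 4, w 5] : List (Fin n)).Nodup ∧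
  φ y (w 0) = φ (w 5) (w 4) ∧
  φ (w 1) (w 0) = φ (w 5) z ∧
  φ (w 3) y = φ (w 1) (w 2) ∧
  φ (w 3) (w 4) = φ z (w 2) ∧
  ([φ y (w 0), φ (w 1) (w 0), φ (w 3) y, φ (w 3) (w 4)] : List (Fin n)).Nodup

def bridgeVerts {n : ℕ} (y z : Fin n) (w : Fin 6 → Fin n) : Finset (Fin n) :=
  insert y (insert z (Finset.image w Finset.univ))

def bridgeHasColour {n : ℕ} (φ : Fin n → Fin n → Fin n) (y z : Fin n)
    (w : Fin 6 → Fin n) (d : Fin n) : Prop :=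
  d = φ y (w 0) ∨ d = φ (w 1) (w 0) ∨ d = φ (w 1) (w 2) ∨ d = φ z (w 2) ∨
  d = φ (w 3) y ∨ d = φ (w 3) (w 4) ∨ d = φ (w 5) (w 4) ∨ d = φ (w 5) z

def WellSpreadBridgeGadgets {n : ℕ} (φ : Fin n → Fin n → Fin n) (y z : Fin n)
    (ℬ : Finset (Fin 6 → Fin n)) : Prop :=
  (∀ u : Fin n, u ≠ y → u ≠ z → (ℬ.filter fun w => u ∈ bridgeVerts y z w).card ≤ n) ∧
  (∀ d : Fin n, (ℬ.filter fun w => bridgeHasColour φ y z w d).card ≤ n)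


/-- The number of loops of colour `c`. -/
def loopCount {n : ℕ} (φ : Fin n → Fin n → Fin n) (c : Fin n) : ℕ :=
  Nat.card {i : Fin n // φ i i = c}

/-- For all `v, c`, a well-spread collection of at least `n²/2¹⁰⁰` `(v,c)`-absorbing
gadgets exists. -/
def HasAbsGadgets {n : ℕ} (φ : Fin n → Fin n → Fin n) : Prop :=
  ∀ v c : Fin n, ∃ 𝒜 : Finset (Fin 6 → Fin n),
    (∀ x ∈ 𝒜, IsAbsGadget φ v c x) ∧ WellSpreadAbsGadgets φ v c 𝒜 ∧
    (n : ℝ) ^ 2 / 2 ^ 100 ≤ 𝒜.card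

/-- For all distinct `y, z`, a well-spread collection of at least `n²/10⁵⁰`
`(y,z)`-bridging gadgets exists. -/
def HasBridgeGadgets {n : ℕ} (φ : Fin n → Fin n → Fin n) : Prop :=
  ∀ y z : Fin n, y ≠ z → ∃ ℬ : Finset (Fin 6 → Fin n),
    (∀ w ∈ ℬ, IsBridgeGadget φ y z w) ∧ WellSpreadBridgeGadgets φ y z ℬ ∧
    (n : ℝ) ^ 2 / 10 ^ 50 ≤ ℬ.card

/-! ### `(y,z,𝒫)`-bridges in `𝒢_D` -/

/-- `(D₁, …, D₆)` is an equitable ordered partition of `D` into six parts. -/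
def IsEquitableSixPartition {n : ℕ} (D : Finset (Fin n)) (P : Fin 6 → Finset (Fin n)) :
    Prop :=
  (∀ i, P i ⊆ D) ∧ (∀ i j, i ≠ j → Disjoint (P i) (P j)) ∧
  (Finset.univ.biUnion P = D) ∧ (∀ i j, (P i).card ≤ (P j).card + 1)

/-- A `(y,z,𝒫)`-bridge in `H ∈ 𝒢_D`. -/
def IsBridge {n : ℕ} {D : Finset (Fin n)} (H : GD n D) (y z : Fin n)
    (P : Fin 6 → Finset (Fin n)) (w : Fin 6 → Fin n) : Prop :=
  ([y, z, w 0, w 1, w 2, w 3, w 4, w 5] : List (Fin n)).Nodup ∧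
  ∃ d₁ d₂ d₃ d₄ d₅ d₆ : {d : Fin n // d ∈ D},
    (d₁ : Fin n) ∈ P 0 ∧ (d₂ : Fin n) ∈ P 1 ∧ (d₃ : Fin n) ∈ P 2 ∧
    (d₄ : Fin n) ∈ P 3 ∧ (d₅ : Fin n) ∈ P 4 ∧ (d₆ : Fin n) ∈ P 5 ∧
    H.1 d₁ y = w 0 ∧ H.1 d₁ (w 5) = w 4 ∧
    H.1 d₂ (w 1) = w 0 ∧ H.1 d₂ (w 5) = z ∧
    H.1 d₃ (w 3) = y ∧ H.1 d₃ (w 1) = w 2 ∧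
    H.1 d₄ (w 3) = w 4 ∧ H.1 d₄ z = w 2 ∧
    H.1 d₅ y = w 1 ∧ H.1 d₆ z = w 4

/-- The ten arcs of a `(y,z,𝒫)`-bridge. -/
def bridgeArcsOf {n : ℕ} (y z : Fin n) (w : Fin 6 → Fin n) : Finset (Fin n × Fin n) :=
  {(y, w 0), (w 1, w 0), (w 1, w 2), (z, w 2), (w 3, y), (w 3, w 4), (w 5, w 4), (w 5, z),
   (y, w 1), (z, w 4)}

/-- The four arcs `w₂→w₁, w₂→w₃, w₄→w₅, w₆→w₅` of a bridge. -/
def keyArcsOf {n : ℕ} (w : Fin 6 → Fin n) : Finset (Fin n × Fin n) :=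
  {(w 1, w 0), (w 1, w 2), (w 3, w 4), (w 5, w 4)}

/-- A distinguishable `(y,z,𝒫)`-bridge: the only bridge containing any of its four key arcs. -/
def IsDistinguishableBridge {n : ℕ} {D : Finset (Fin n)} (H : GD n D) (y z : Fin n)
    (P : Fin 6 → Finset (Fin n)) (w : Fin 6 → Fin n) : Prop :=
  IsBridge H y z P w ∧
  ∀ w' : Fin 6 → Fin n, IsBridge H y z P w' →
    ¬ Disjoint (keyArcsOf w) (bridgeArcsOf y z w') → w' = w

/-- `r_{(y,z,𝒫)}(H)`: the number of distinguishable `(y,z,𝒫)`-bridges in `H`. -/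
def distBridgeCount {n : ℕ} {D : Finset (Fin n)} (H : GD n D) (y z : Fin n)
    (P : Fin 6 → Finset (Fin n)) : ℕ :=
  Nat.card {w : Fin 6 → Fin n // IsDistinguishableBridge H y z P w}

/-- Membership in `Q̂_D^{(y,z,𝒫)} = ⋃_{s=0}^{n|D|} M_s^{(y,z,𝒫)}`. -/
def InQhat {n : ℕ} {D : Finset (Fin n)} (H : GD n D) (y z : Fin n)
    (P : Fin 6 → Finset (Fin n)) : Prop :=
  distBridgeCount H y z P ≤ n * D.card ∧
  ∀ A₁ A₂ : Finset (Fin n), A₁.card = D.card → A₂.card = D.card →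
    (eArcs H A₁ A₂ : ℝ) ≤ 2 * (D.card : ℝ) ^ 3 / n + 12 * distBridgeCount H y z P

/-- A `(y,z)`-bridging gadget of `H ∈ 𝒢_D`. -/
def IsBridgeGadgetGD {n : ℕ} {D : Finset (Fin n)} (H : GD n D) (y z : Fin n)
    (w : Fin 6 → Fin n) : Prop :=
  ([y, z, w 0, w 1, w 2, w 3, w 4, w 5] : List (Fin n)).Nodup ∧
  ∃ d₁ d₂ d₃ d₄ : {d : Fin n // d ∈ D},
    ([(d₁ : Fin n), (d₂ : Fin n), (d₃ : Fin n), (d₄ : Fin n)] : List (Fin n)).Nodup ∧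
    H.1 d₁ y = w 0 ∧ H.1 d₁ (w 5) = w 4 ∧
    H.1 d₂ (w 1) = w 0 ∧ H.1 d₂ (w 5) = z ∧
    H.1 d₃ (w 3) = y ∧ H.1 d₃ (w 1) = w 2 ∧
    H.1 d₄ (w 3) = w 4 ∧ H.1 d₄ z = w 2

/-- The gadget (in `H ∈ 𝒢_D`) contains an arc of colour `d`. -/
def bridgeGadgetGDHasColour {n : ℕ} {D : Finset (Fin n)} (H : GD n D) (y z : Fin n)
    (w : Fin 6 → Fin n) (d : Fin n) : Prop :=
  ∃ d' : {d : Fin n // d ∈ D}, (d' : Fin n) = d ∧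
    (H.1 d' y = w 0 ∨ H.1 d' (w 1) = w 0 ∨ H.1 d' (w 1) = w 2 ∨ H.1 d' z = w 2 ∨
     H.1 d' (w 3) = y ∨ H.1 d' (w 3) = w 4 ∨ H.1 d' (w 5) = w 4 ∨ H.1 d' (w 5) = z)

def WellSpreadBridgeGadgetsGD {n : ℕ} {D : Finset (Fin n)} (H : GD n D) (y z : Fin n)
    (ℬ : Finset (Fin 6 → Fin n)) : Prop :=
  (∀ u : Fin n, u ≠ y → u ≠ z → (ℬ.filter fun w => u ∈ bridgeVerts y z w).card ≤ n) ∧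
  (∀ d : Fin n, (ℬ.filter fun w => bridgeGadgetGDHasColour H y z w d).card ≤ n)

/-! ### Directed paths, absorbers, `T`-absorbers -/

/-- The arcs of the directed path whose vertices are the entries of `p`, in order. -/
def pathArcs {n : ℕ} (p : List (Fin n)) : List (Fin n × Fin n) := p.zip p.tail

def pathColours {n : ℕ} (φ : Fin n → Fin n → Fin n) (p : List (Fin n)) : List (Fin n) :=
  (pathArcs p).map fun e => φ e.1 e.2

def internalVerts {n : ℕ} (p : List (Fin n)) : List (Fin n) := (p.drop 1).dropLast

set_option maxHeartbeats 1600000 in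
/-- A `(v,c)`-absorber: a `(v,c)`-absorbing gadget with vertices `x`, bridged by an
`(x₄,x₅)`-bridging gadget with vertices `w`, completed by four rainbow directed paths. -/
structure Absorber (n : ℕ) (φ : Fin n → Fin n → Fin n) (v c : Fin n) where
  x : Fin 6 → Fin n
  w : Fin 6 → Fin n
  P : Fin 4 → List (Fin n)
  gadget : IsAbsGadget φ v c x
  bridge : IsBridgeGadget φ (x 3) (x 4) w
  meetAB : absGadgetVerts v x ∩ bridgeVerts (x 3) (x 4) w = {x 3, x 4}
  colourDisjointAB :
    ∀ d : Fin n, absGadgetHasColour φ v x d → bridgeHasColour φ (x 3) (x 4) w d → False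
  pathNodup : ∀ i, (P i).Nodup
  pathEnds :
    (P 0).head? = some (x 1) ∧ (P 0).getLast? = some (x 2) ∧
    (P 1).head? = some (w 0) ∧ (P 1).getLast? = some (w 3) ∧
    (P 2).head? = some (w 4) ∧ (P 2).getLast? = some (w 1) ∧
    (P 3).head? = some (w 2) ∧ (P 3).getLast? = some (w 5)
  pathsDisjoint : ∀ i j, i ≠ j → ∀ a ∈ P i, a ∉ P j
  pathInternalDisjoint : ∀ i, ∀ a ∈ internalVerts (P i),
    a ∉ absGadgetVerts v x ∧ a ∉ bridgeVerts (x 3) (x 4) w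
  pathsRainbowEach : ∀ i, (pathColours φ (P i)).Nodup
  pathsRainbowPair : ∀ i j, i ≠ j → ∀ d ∈ pathColours φ (P i), d ∉ pathColours φ (P j)
  pathColoursNew : ∀ i, ∀ d ∈ pathColours φ (P i),
    ¬ absGadgetHasColour φ v x d ∧ ¬ bridgeHasColour φ (x 3) (x 4) w d

def Absorber.arcs {n : ℕ} {φ : Fin n → Fin n → Fin n} {v c : Fin n}
    (A : Absorber n φ v c) : Finset (Fin n × Fin n) :=
  ({(A.x 0, v), (v, A.x 1), (A.x 0, A.x 1), (A.x 2, A.x 3), (A.x 2, A.x 4),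
    (A.x 3, A.x 5), (A.x 4, A.x 5)} : Finset (Fin n × Fin n)) ∪
  ({(A.x 3, A.w 0), (A.w 1, A.w 0), (A.w 1, A.w 2), (A.x 4, A.w 2), (A.w 3, A.x 3),
    (A.w 3, A.w 4), (A.w 5, A.w 4), (A.w 5, A.x 4)} : Finset (Fin n × Fin n)) ∪
  Finset.univ.biUnion fun i : Fin 4 => (pathArcs (A.P i)).toFinset

def Absorber.verts {n : ℕ} {φ : Fin n → Fin n → Fin n} {v c : Fin n}
    (A : Absorber n φ v c) : Finset (Fin n) :=
  absGadgetVerts v A.x ∪ bridgeVerts (A.x 3) (A.x 4) A.w ∪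
    Finset.univ.biUnion fun i : Fin 4 => (A.P i).toFinset

def Absorber.colours {n : ℕ} {φ : Fin n → Fin n → Fin n} {v c : Fin n}
    (A : Absorber n φ v c) : Finset (Fin n) :=
  A.arcs.image fun e => φ e.1 e.2

def Absorber.initial {n : ℕ} {φ : Fin n → Fin n → Fin n} {v c : Fin n}
    (A : Absorber n φ v c) : Fin n := A.x 0

def Absorber.terminal {n : ℕ} {φ : Fin n → Fin n → Fin n} {v c : Fin n}
    (A : Absorber n φ v c) : Fin n := A.x 5

/-- A `T`-absorber inside the coloured `K_n^↔`, with arc set `H`. -/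
structure TAbsorber (n : ℕ) (φ : Fin n → Fin n → Fin n) {α β : Type}
    [Fintype α] [Fintype β] [DecidableEq α] [DecidableEq β]
    (T : Finset (α × β)) (H : Finset (Fin n × Fin n)) where
  fV : α → Fin n
  fC : β → Fin n
  fVinj : Function.Injective fV
  fCinj : Function.Injective fC
  fCrange : ∀ b : β, fC b ∈ H.image fun e : Fin n × Fin n => φ e.1 e.2
  Ab : (e : α × β) → e ∈ T → Absorber n φ (fV e.1) (fC e.2)
  AbSub : ∀ e he, (Ab e he).arcs ⊆ H
  AbUnique : ∀ e he (A' : Absorber n φ (fV e.1) (fC e.2)),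
    A'.arcs ⊆ H → A'.arcs = (Ab e he).arcs
  AbVertexDisjoint : ∀ e he e' he', e ≠ e' →
    ∀ u : Fin n, u ∈ (Ab e he).verts → u ∈ (Ab e' he').verts → e.1 = e'.1 ∧ u = fV e.1
  AbColourDisjoint : ∀ e he e' he', e ≠ e' →
    ∀ d : Fin n, d ∈ (Ab e he).colours → d ∈ (Ab e' he').colours → e.2 = e'.2 ∧ d = fC e.2
  es : Fin T.card → α × β
  esInj : Function.Injective es
  esMem : ∀ i, es i ∈ T
  link : Fin (T.card - 1) → List (Fin n)
  linkLen : ∀ i, (link i).length = 4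
  linkNodup : ∀ i, (link i).Nodup
  linkSub : ∀ i, ∀ e ∈ pathArcs (link i), e ∈ H
  linkPairwiseDisjoint : ∀ i j, i ≠ j → ∀ a ∈ link i, a ∉ link j
  linkRainbowEach : ∀ i, (pathColours φ (link i)).Nodup
  linkRainbowPair : ∀ i j, i ≠ j → ∀ d ∈ pathColours φ (link i), d ∉ pathColours φ (link j)
  linkColourNew : ∀ i, ∀ d ∈ pathColours φ (link i), ∀ e he, d ∉ (Ab e he).colours
  linkHead : ∀ i : Fin (T.card - 1),
    (link i).head? = some (Ab (es (Fin.castLE (Nat.sub_le _ _) i)) (esMem _)).terminal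
  linkLast : ∀ i : Fin (T.card - 1),
    (link i).getLast? =
      some (Ab (es ⟨i.1 + 1, by have := i.2; omega⟩) (esMem _)).initial
  linkInternalDisjoint : ∀ i, ∀ a ∈ internalVerts (link i), ∀ e he, a ∉ (Ab e he).verts
  minimal : H = (T.attach.biUnion fun e => (Ab e.1 e.2).arcs) ∪
      (Finset.univ.biUnion fun i => (pathArcs (link i)).toFinset)

def TAbsorber.initialVtx {n : ℕ} {φ : Fin n → Fin n → Fin n} {α β : Type}
    [Fintype α] [Fintype β] [DecidableEq α] [DecidableEq β]
    {T : Finset (α × β)} {H : Finset (Fin n × Fin n)} (𝔸 : TAbsorber n φ T H)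
    (h : 0 < T.card) : Fin n :=
  (𝔸.Ab (𝔸.es ⟨0, h⟩) (𝔸.esMem _)).initial

def TAbsorber.terminalVtx {n : ℕ} {φ : Fin n → Fin n → Fin n} {α β : Type}
    [Fintype α] [Fintype β] [DecidableEq α] [DecidableEq β]
    {T : Finset (α × β)} {H : Finset (Fin n × Fin n)} (𝔸 : TAbsorber n φ T H)
    (h : 0 < T.card) : Fin n :=
  (𝔸.Ab (𝔸.es ⟨T.card - 1, Nat.sub_lt h Nat.one_pos⟩) (𝔸.esMem _)).terminal

/-- `T` (bipartite, edge set a finset of `α × β`) is robustly matchable with respect to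
flexible sets `A'`, `B'`. -/
def RobustlyMatchable {α β : Type} [DecidableEq α] [DecidableEq β]
    (T : Finset (α × β)) (A' : Finset α) (B' : Finset β) : Prop :=
  ∀ X : Finset α, ∀ Y : Finset β, X ⊆ A' → Y ⊆ B' → X.card = Y.card →
    (X.card : ℝ) ≤ min ((A'.card : ℝ) / 2) ((B'.card : ℝ) / 2) →
    ∃ M : Finset (α × β), M ⊆ T ∧ (∀ e ∈ M, e.1 ∉ X ∧ e.2 ∉ Y) ∧
      (∀ a : α, a ∉ X → ∃! e, e ∈ M ∧ e.1 = a) ∧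
      (∀ b : β, b ∉ Y → ∃! e, e ∈ M ∧ e.2 = b)

def arcVerts {n : ℕ} (H : Finset (Fin n × Fin n)) : Finset (Fin n) :=
  H.image Prod.fst ∪ H.image Prod.snd

/-- `H` (an arc set in the coloured `K_n^↔`) is robustly rainbow-Hamiltonian with respect
to flexible sets `Vf`, `Cf` and initial and terminal vertices `u`, `v`. -/
def RobustlyRainbowHam {n : ℕ} (φ : Fin n → Fin n → Fin n) (H : Finset (Fin n × Fin n))
    (Vf Cf : Finset (Fin n)) (u v : Fin n) : Prop :=
  ∀ X Y : Finset (Fin n), X ⊆ Vf → Y ⊆ Cf → X.card = Y.card →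
    (X.card : ℝ) ≤ min ((Vf.card : ℝ) / 2) ((Cf.card : ℝ) / 2) →
    ∃ p : List (Fin n), p.Nodup ∧ p.head? = some u ∧ p.getLast? = some v ∧
      (∀ e ∈ pathArcs p, e ∈ H) ∧
      (∀ a ∈ p, a ∉ X) ∧
      p.toFinset = arcVerts H \ X ∧
      (pathColours φ p).Nodup ∧
      (∀ d ∈ pathColours φ p, d ∉ Y)

/-! ### Lower-quasirandomness and rainbow directed path forests -/

/-- `e_{G,D}(U₁,U₂)`: the number of arcs with tail in `U₁`, head in `U₂`, colour in `D`. -/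
def colArcCount {n : ℕ} (φ : Fin n → Fin n → Fin n) (U₁ U₂ D : Finset (Fin n)) : ℕ :=
  Nat.card {p : Fin n × Fin n // p.1 ∈ U₁ ∧ p.2 ∈ U₂ ∧ φ p.1 p.2 ∈ D}

def LowerQuasirandom {n : ℕ} (φ : Fin n → Fin n → Fin n) : Prop :=
  ∀ U₁ U₂ D : Finset (Fin n),
    (U₁.card : ℝ) * U₂.card * D.card / n - (n : ℝ) ^ (5 / 3 : ℝ) ≤ colArcCount φ U₁ U₂ D

/-- The arc set `Q` contains a directed cycle (a loop counts as a cycle of length one). -/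
def HasDiCycle {n : ℕ} (Q : Finset (Fin n × Fin n)) : Prop :=
  ∃ (a : Fin n) (l : List (Fin n)), (a :: l).Nodup ∧
    List.Chain (fun u v : Fin n => (u, v) ∈ Q) a l ∧
    ((a :: l).getLast (List.cons_ne_nil a l), a) ∈ Q

/-- `Q` is (the arc set of) a spanning rainbow directed path forest of `G − U`, using no
colour of `D`, with at most `n^{9/10}` components. -/
def IsGoodPathForest {n : ℕ} (φ : Fin n → Fin n → Fin n) (U D : Finset (Fin n))
    (Q : Finset (Fin n × Fin n)) : Prop :=
  (∀ e ∈ Q, e.1 ∉ U ∧ e.2 ∉ U) ∧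
  (∀ e ∈ Q, ∀ e' ∈ Q, e ≠ e' → e.1 ≠ e'.1 ∧ e.2 ≠ e'.2) ∧
  ¬ HasDiCycle Q ∧
  Set.InjOn (fun e : Fin n × Fin n => φ e.1 e.2) (Q : Set (Fin n × Fin n)) ∧
  (∀ e ∈ Q, φ e.1 e.2 ∉ D) ∧
  ((n : ℝ) - U.card - Q.card ≤ (n : ℝ) ^ (9 / 10 : ℝ))


instance {n : ℕ} {D : Finset (Fin n)} : Finite (GD n D) := by
  unfold GD
  infer_instance

instance {n : ℕ} {D : Finset (Fin n)} : Fintype (GD n D) := Fintype.ofFinite _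

/-- The colour class `d` of `H`, as a permutation of the vertices. -/
def GD.perm {n : ℕ} {D : Finset (Fin n)} (H : GD n D) (d : {d : Fin n // d ∈ D}) :
    Equiv.Perm (Fin n) :=
  Equiv.ofBijective (H.1 d) (H.2.1 d)

section Twist

variable {n : ℕ} {D : Finset (Fin n)}

lemma GD.ext_perm {H H' : GD n D} (h : ∀ d, H.perm d = H'.perm d) : H = H' := by
  apply Subtype.ext
  funext d i
  exact congrArg (fun f : Equiv.Perm (Fin n) => f i) (h d)

lemma GD.perm_inj (H : GD n D) {d d' : {d : Fin n // d ∈ D}} {i : Fin n}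
    (h : H.perm d i = H.perm d' i) : d = d' :=
  H.2.2 i h

lemma GD.perm_symm_inj (H : GD n D) {d d' : {d : Fin n // d ∈ D}} {i : Fin n}
    (h : (H.perm d).symm i = (H.perm d').symm i) : d = d' := by
  apply H.perm_inj (i := (H.perm d).symm i)
  rw [Equiv.apply_symm_apply, h, Equiv.apply_symm_apply]

lemma GD.exists_perm_eq (f : {d : Fin n // d ∈ D} → Equiv.Perm (Fin n))
    (hf : ∀ i d d', f d i = f d' i → d = d') : ∃ H : GD n D, ∀ d, H.perm d = f d :=
  ⟨⟨fun d => f d, fun d => (f d).bijective, fun i d d' h => hf i d d' h⟩, fun _ =>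
    Equiv.ext fun _ => rfl⟩

/-! ### Bridges as tuples of colours -/

/-- A bridge is determined by its colours `d₁, …, d₆`: the colour `dⱼ` determines one vertex
of the bridge, a neighbour of `y` or of `z`. In order these are `w₁, w₆, w₄, w₃, w₂, w₅`. -/
def slotVertex (H : GD n D) (y z : Fin n) (j : Fin 6) (d : {d : Fin n // d ∈ D}) : Fin n :=
  match j with
  | 0 => H.perm d y
  | 1 => (H.perm d).symm z
  | 2 => (H.perm d).symm y
  | 3 => H.perm d z
  | 4 => H.perm d y
  | 5 => H.perm d z

/-- The colour slot of each of the four key arcs. -/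
def colSlot : Fin 4 → Fin 6 := ![0, 1, 2, 3]

/-- The slot of the tail of each of the four key arcs. -/
def tailSlot : Fin 4 → Fin 6 := ![1, 4, 4, 2]

/-- The slot of the head of each of the four key arcs. -/
def headSlot : Fin 4 → Fin 6 := ![5, 0, 3, 5]

lemma colSlot_injective : Function.Injective colSlot := by decide

lemma colSlot_ne_tailSlot : ∀ k, colSlot k ≠ tailSlot k := by decide

lemma colSlot_ne_headSlot : ∀ k, colSlot k ≠ headSlot k := by decide

lemma tailSlot_ne_headSlot : ∀ k, tailSlot k ≠ headSlot k := by decide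

lemma eq_of_tailSlot_headSlot :
    ∀ k l, tailSlot k = tailSlot l → headSlot k = headSlot l → k = l := by decide

lemma slotVertex_injective (H : GD n D) (y z : Fin n) (j : Fin 6) :
    Function.Injective (slotVertex H y z j) := by
  intro d d' h
  fin_cases j
  · exact H.perm_inj h
  · exact H.perm_symm_inj h
  · exact H.perm_symm_inj h
  · exact H.perm_inj h
  · exact H.perm_inj h
  · exact H.perm_inj h

/-- The tuple `t` of colours spans a `(y,z,𝒫)`-bridge. -/
structure IsBridgeTuple (H : GD n D) (y z : Fin n) (P : Fin 6 → Finset (Fin n))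
    (t : Fin 6 → {d : Fin n // d ∈ D}) : Prop where
  mem : ∀ j, (t j : Fin n) ∈ P j
  ne_y : ∀ j, slotVertex H y z j (t j) ≠ y
  ne_z : ∀ j, slotVertex H y z j (t j) ≠ z
  inj : ∀ i j, i ≠ j → slotVertex H y z i (t i) ≠ slotVertex H y z j (t j)
  key : ∀ k, H.perm (t (colSlot k)) (slotVertex H y z (tailSlot k) (t (tailSlot k))) =
    slotVertex H y z (headSlot k) (t (headSlot k))

/-- The vertices `w₁, …, w₆` spanned by a tuple of colours. -/
def tupleVerts (H : GD n D) (y z : Fin n) (t : Fin 6 → {d : Fin n // d ∈ D}) :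
    Fin 6 → Fin n :=
  ![slotVertex H y z 0 (t 0), slotVertex H y z 4 (t 4), slotVertex H y z 3 (t 3),
    slotVertex H y z 2 (t 2), slotVertex H y z 5 (t 5), slotVertex H y z 1 (t 1)]

lemma tupleVerts_injective (H : GD n D) (y z : Fin n) :
    Function.Injective (tupleVerts H y z) := by
  intro t t' h
  funext j
  apply slotVertex_injective H y z j
  fin_cases j
  · exact congrFun h 0
  · exact congrFun h 5
  · exact congrFun h 3
  · exact congrFun h 2
  · exact congrFun h 1
  · exact congrFun h 4

lemma isBridge_iff_exists_tuple (H : GD n D) {y z : Fin n} (hyz : y ≠ z)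
    (P : Fin 6 → Finset (Fin n)) (w : Fin 6 → Fin n) :
    IsBridge H y z P w ↔ ∃ t, IsBridgeTuple H y z P t ∧ tupleVerts H y z t = w := by
  constructor
  · rintro ⟨hnd, d₁, d₂, d₃, d₄, d₅, d₆, h1, h2, h3, h4, h5, h6, e1, e2, e3, e4, e5, e6, e7,
      e8, e9, e10⟩
    have s0 : slotVertex H y z 0 d₁ = w 0 := e1
    have s1 : slotVertex H y z 1 d₂ = w 5 := (Equiv.symm_apply_eq _).2 e4.symm
    have s2 : slotVertex H y z 2 d₃ = w 3 := (Equiv.symm_apply_eq _).2 e5.symm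
    have s3 : slotVertex H y z 3 d₄ = w 2 := e8
    have s4 : slotVertex H y z 4 d₅ = w 1 := e9
    have s5 : slotVertex H y z 5 d₆ = w 4 := e10
    simp only [List.nodup_cons, List.mem_cons, List.not_mem_nil, or_false, not_or,
      List.nodup_nil, not_false_eq_true, and_true] at hnd
    refine ⟨![d₁, d₂, d₃, d₄, d₅, d₆], ⟨?_, ?_, ?_, ?_, ?_⟩, ?_⟩
    · intro j; fin_cases j <;> assumption
    · intro j
      fin_cases j <;>
        simp only [Fin.zero_eta, Fin.mk_one, Fin.reduceFinMk, Matrix.cons_val, s0, s1, s2, s3,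
          s4, s5] <;> grind
    · intro j
      fin_cases j <;>
        simp only [Fin.zero_eta, Fin.mk_one, Fin.reduceFinMk, Matrix.cons_val, s0, s1, s2, s3,
          s4, s5] <;> grind
    · intro i j hij
      fin_cases i <;> fin_cases j <;>
        simp only [Fin.zero_eta, Fin.mk_one, Fin.reduceFinMk, Matrix.cons_val, s0, s1, s2, s3,
          s4, s5] <;> grind
    · intro k
      fin_cases k <;>
        simp only [Fin.zero_eta, Fin.mk_one, Fin.reduceFinMk, Matrix.cons_val, colSlot, tailSlot,
          headSlot, s0, s1, s2, s3, s4, s5] <;> assumption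
    · funext j
      fin_cases j
      · exact s0
      · exact s4
      · exact s3
      · exact s2
      · exact s5
      · exact s1
  · rintro ⟨t, ht, rfl⟩
    refine ⟨?_, t 0, t 1, t 2, t 3, t 4, t 5, ht.mem 0, ht.mem 1, ht.mem 2, ht.mem 3, ht.mem 4,
      ht.mem 5, rfl, ht.key 0, ht.key 1, Equiv.apply_symm_apply (H.perm (t 1)) z,
      Equiv.apply_symm_apply (H.perm (t 2)) y, ht.key 2, ht.key 3, rfl, rfl, rfl⟩
    have hy := ht.ne_y
    have hz := ht.ne_z
    have hi := ht.inj
    simp only [tupleVerts, List.nodup_cons, List.mem_cons, List.not_mem_nil, or_false, not_or,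
      List.nodup_nil, not_false_eq_true, and_true, Matrix.cons_val]
    refine ⟨⟨hyz, (hy _).symm, (hy _).symm, (hy _).symm, (hy _).symm, (hy _).symm, (hy _).symm⟩,
      ⟨(hz _).symm, (hz _).symm, (hz _).symm, (hz _).symm, (hz _).symm, (hz _).symm⟩,
      ⟨?_, ?_, ?_, ?_, ?_⟩, ⟨?_, ?_, ?_, ?_⟩, ⟨?_, ?_, ?_⟩, ⟨?_, ?_⟩, ?_⟩ <;>
    exact hi _ _ (by decide)

/-! ### Twists -/

/-- The permutation `u ↦ a ↦ c ↦ u`. -/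
def threeCycle (u a c : Fin n) : Equiv.Perm (Fin n) := Equiv.swap u a * Equiv.swap a c

lemma threeCycle_cases {u a c : Fin n} (hua : u ≠ a) (huc : u ≠ c) (hac : a ≠ c) (i : Fin n) :
    (i ≠ u ∧ i ≠ a ∧ i ≠ c ∧ threeCycle u a c i = i) ∨ (i = u ∧ threeCycle u a c i = a) ∨
      (i = a ∧ threeCycle u a c i = c) ∨ (i = c ∧ threeCycle u a c i = u) := by
  simp only [threeCycle, Equiv.Perm.mul_apply, Equiv.swap_apply_def]
  grind

/-- Apply the three-cycle `u k ↦ a k ↦ c k ↦ u k` in the colour of the `k`-th key arc. -/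
def twistPerm (t : Fin 6 → {d : Fin n // d ∈ D}) (u a c : Fin 4 → Fin n)
    (d : {d : Fin n // d ∈ D}) : Equiv.Perm (Fin n) :=
  if h : ∃ k, t (colSlot k) = d then threeCycle (u h.choose) (a h.choose) (c h.choose) else 1

lemma twistPerm_colSlot {t : Fin 6 → {d : Fin n // d ∈ D}} (ht : Function.Injective t)
    (u a c : Fin 4 → Fin n) (k : Fin 4) :
    twistPerm t u a c (t (colSlot k)) = threeCycle (u k) (a k) (c k) := by
  have h : ∃ l, t (colSlot l) = t (colSlot k) := ⟨k, rfl⟩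
  have hk : h.choose = k := colSlot_injective (ht h.choose_spec)
  rw [twistPerm, dif_pos h, hk]

lemma twistPerm_of_ne {t : Fin 6 → {d : Fin n // d ∈ D}} (u a c : Fin 4 → Fin n)
    {d : {d : Fin n // d ∈ D}} (h : ∀ k, t (colSlot k) ≠ d) : twistPerm t u a c d = 1 := by
  rw [twistPerm, dif_neg (by simpa using h)]

/-- The tail of the `k`-th key arc prescribed by `t`. -/
def keyTail (H : GD n D) (y z : Fin n) (t : Fin 6 → {d : Fin n // d ∈ D}) (k : Fin 4) : Fin n :=
  slotVertex H y z (tailSlot k) (t (tailSlot k))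

/-- The head of the `k`-th key arc prescribed by `t`. -/
def keyHead (H : GD n D) (y z : Fin n) (t : Fin 6 → {d : Fin n // d ∈ D}) (k : Fin 4) : Fin n :=
  slotVertex H y z (headSlot k) (t (headSlot k))

/-- The present head, in the prescribed colour, of the tail of the `k`-th key arc. -/
def oldHead (H : GD n D) (y z : Fin n) (t : Fin 6 → {d : Fin n // d ∈ D}) (k : Fin 4) : Fin n :=
  H.perm (t (colSlot k)) (keyTail H y z t k)

/-- The present tail, in the prescribed colour, of the head of the `k`-th key arc. -/
def oldTail (H : GD n D) (y z : Fin n) (t : Fin 6 → {d : Fin n // d ∈ D}) (k : Fin 4) : Fin n :=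
  (H.perm (t (colSlot k))).symm (keyHead H y z t k)

/-- The tuple `t` can be turned into a bridge by a twist that affects no other bridge. -/
structure IsGoodTuple (H : GD n D) (y z : Fin n) (P : Fin 6 → Finset (Fin n))
    (t : Fin 6 → {d : Fin n // d ∈ D}) : Prop where
  mem : ∀ j, (t j : Fin n) ∈ P j
  ne_y : ∀ j, slotVertex H y z j (t j) ≠ y
  ne_z : ∀ j, slotVertex H y z j (t j) ≠ z
  inj : ∀ i j, i ≠ j → slotVertex H y z i (t i) ≠ slotVertex H y z j (t j)
  key_notMem : ∀ k q, H.perm q (keyTail H y z t k) ≠ keyHead H y z t k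
  oldHead_ne_y : ∀ k, oldHead H y z t k ≠ y
  oldHead_ne_z : ∀ k, oldHead H y z t k ≠ z
  oldTail_ne_y : ∀ k, oldTail H y z t k ≠ y
  oldTail_ne_z : ∀ k, oldTail H y z t k ≠ z
  oldHead_notMem : ∀ k d, oldHead H y z t k ≠ slotVertex H y z (headSlot k) d
  oldTail_notMem : ∀ k d, oldTail H y z t k ≠ slotVertex H y z (tailSlot k) d
  no_completion₂₃ : ∀ p q, H.perm p (slotVertex H y z 4 (t 4)) = slotVertex H y z 3 q →
    H.perm q (slotVertex H y z 2 p) ≠ slotVertex H y z 5 (t 5)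
  no_completion₁₀ : ∀ p q, H.perm p (slotVertex H y z 4 (t 4)) = slotVertex H y z 0 q →
    H.perm q (slotVertex H y z 1 p) ≠ slotVertex H y z 5 (t 5)

/-- The tails `c k` can be used as the third tails of a twist along the good tuple `t`. -/
structure IsGoodShift (H : GD n D) (y z : Fin n) (t : Fin 6 → {d : Fin n // d ∈ D})
    (c : Fin 4 → Fin n) : Prop where
  ne_y : ∀ k, c k ≠ y
  ne_z : ∀ k, c k ≠ z
  head_ne_y : ∀ k, H.perm (t (colSlot k)) (c k) ≠ y
  head_ne_z : ∀ k, H.perm (t (colSlot k)) (c k) ≠ z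
  notMem : ∀ k d, c k ≠ slotVertex H y z (tailSlot k) d
  ne_vertex : ∀ k j, c k ≠ slotVertex H y z j (t j)
  ne_oldTail : ∀ k l, c k ≠ oldTail H y z t l
  head_ne_vertex : ∀ k j, H.perm (t (colSlot k)) (c k) ≠ slotVertex H y z j (t j)
  arc_oldHead : ∀ k q, H.perm q (c k) ≠ oldHead H y z t k
  oldTail_arc : ∀ k q, H.perm q (oldTail H y z t k) ≠ H.perm (t (colSlot k)) (c k)
  inj : ∀ k l, k ≠ l → c k ≠ c l
  head_inj : ∀ k l, k ≠ l → H.perm (t (colSlot k)) (c k) ≠ H.perm (t (colSlot l)) (c l)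

/-- `H'` arises from `H` by the twist along `t` and `c`. -/
def IsTwist (H : GD n D) (y z : Fin n) (t : Fin 6 → {d : Fin n // d ∈ D}) (c : Fin 4 → Fin n)
    (H' : GD n D) : Prop :=
  ∀ d, H'.perm d = H.perm d * twistPerm t (keyTail H y z t) (oldTail H y z t) c d

variable {H H' : GD n D} {y z : Fin n} {P : Fin 6 → Finset (Fin n)}
  {t : Fin 6 → {d : Fin n // d ∈ D}} {c : Fin 4 → Fin n}

lemma slot_eq_of_mem (hP : ∀ i j, i ≠ j → Disjoint (P i) (P j)) {t' : Fin 6 → {d : Fin n // d ∈ D}}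
    (ht : ∀ j, (t j : Fin n) ∈ P j) (ht' : ∀ j, (t' j : Fin n) ∈ P j) {i j : Fin 6}
    (h : t i = t' j) : i = j := by
  by_contra hij
  exact Finset.disjoint_left.1 (hP i j hij) (ht i) (h ▸ ht' j)

lemma twist_cases (ht : IsGoodTuple H y z P t) (hinj : Function.Injective t)
    (hc : IsGoodShift H y z t c) (d : {d : Fin n // d ∈ D}) (i : Fin n) :
    let f' := fun d => H.perm d * twistPerm t (keyTail H y z t) (oldTail H y z t) c d
    ((∀ k, d = t (colSlot k) → i ≠ keyTail H y z t k ∧ i ≠ oldTail H y z t k ∧ i ≠ c k) ∧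
        f' d i = H.perm d i) ∨
      ∃ k, d = t (colSlot k) ∧
        ((i = keyTail H y z t k ∧ H.perm d i = oldHead H y z t k ∧ f' d i = keyHead H y z t k) ∨
         (i = oldTail H y z t k ∧ H.perm d i = keyHead H y z t k ∧
            f' d i = H.perm (t (colSlot k)) (c k)) ∨
         (i = c k ∧ H.perm d i = H.perm (t (colSlot k)) (c k) ∧ f' d i = oldHead H y z t k)) := by
  intro f'
  by_cases h : ∃ k, d = t (colSlot k)
  · obtain ⟨k, rfl⟩ := h
    have hT : H.perm (t (colSlot k)) (oldTail H y z t k) = keyHead H y z t k :=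
      Equiv.apply_symm_apply _ _
    have hf : f' (t (colSlot k)) i =
        H.perm (t (colSlot k)) (threeCycle (keyTail H y z t k) (oldTail H y z t k) (c k) i) := by
      simp only [f', Equiv.Perm.mul_apply, twistPerm_colSlot hinj]
    rcases threeCycle_cases (ht.oldTail_notMem k _).symm (hc.ne_vertex k _).symm
      (hc.ne_oldTail k k).symm i with ⟨h1, h2, h3, h4⟩ | ⟨rfl, h4⟩ | ⟨rfl, h4⟩ | ⟨rfl, h4⟩
    · left
      refine ⟨fun l hl => ?_, by rw [hf]; exact congrArg _ h4⟩
      obtain rfl := colSlot_injective (hinj hl)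
      exact ⟨h1, h2, h3⟩
    · refine Or.inr ⟨k, rfl, Or.inl ⟨rfl, rfl, ?_⟩⟩
      rw [hf, ← hT]; exact congrArg _ h4
    · refine Or.inr ⟨k, rfl, Or.inr (Or.inl ⟨rfl, hT, ?_⟩)⟩
      rw [hf]; exact congrArg _ h4
    · refine Or.inr ⟨k, rfl, Or.inr (Or.inr ⟨rfl, rfl, ?_⟩)⟩
      rw [hf]; exact congrArg _ h4
  · push Not at h
    refine Or.inl ⟨fun k hk => absurd hk (h k), ?_⟩
    simp only [f', Equiv.Perm.mul_apply, twistPerm_of_ne _ _ _ fun k => (h k).symm,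
      Equiv.Perm.one_apply]

lemma exists_isTwist (ht : IsGoodTuple H y z P t) (hinj : Function.Injective t)
    (hc : IsGoodShift H y z t c) : ∃ H', IsTwist H y z t c H' := by
  apply GD.exists_perm_eq
  intro i d d' h
  have hkey : ∀ k l, keyTail H y z t k = keyTail H y z t l →
      keyHead H y z t k = keyHead H y z t l → k = l := by
    intro k l h1 h2
    refine eq_of_tailSlot_headSlot k l ?_ ?_ <;> by_contra hne
    · exact ht.inj _ _ hne h1
    · exact ht.inj _ _ hne h2
  have h1 := ht.key_notMem
  have h2 : ∀ k l, c k ≠ keyTail H y z t l := fun k l => hc.ne_vertex k _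
  have h3 : ∀ k l, H.perm (t (colSlot k)) (c k) ≠ keyHead H y z t l :=
    fun k l => hc.head_ne_vertex k _
  have h4 := hc.ne_oldTail
  have h5 := hc.arc_oldHead
  have h6 := hc.oldTail_arc
  have h7 := hc.inj
  have h8 := hc.head_inj
  rcases twist_cases ht hinj hc d i with ⟨-, e⟩ | ⟨k, hk, ⟨a1, a2, a3⟩ | ⟨a1, a2, a3⟩ | ⟨a1, a2, a3⟩⟩ <;>
  rcases twist_cases ht hinj hc d' i with
    ⟨-, e'⟩ | ⟨l, hl, ⟨b1, b2, b3⟩ | ⟨b1, b2, b3⟩ | ⟨b1, b2, b3⟩⟩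
  · exact H.perm_inj (e.symm.trans (h.trans e'))
  all_goals grind

lemma IsTwist.cases (hH' : IsTwist H y z t c H') (ht : IsGoodTuple H y z P t)
    (hinj : Function.Injective t) (hc : IsGoodShift H y z t c) (d : {d : Fin n // d ∈ D})
    (i : Fin n) :
    ((∀ k, d = t (colSlot k) → i ≠ keyTail H y z t k ∧ i ≠ oldTail H y z t k ∧ i ≠ c k) ∧
        H'.perm d i = H.perm d i) ∨
      ∃ k, d = t (colSlot k) ∧
        ((i = keyTail H y z t k ∧ H.perm d i = oldHead H y z t k ∧
            H'.perm d i = keyHead H y z t k) ∨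
         (i = oldTail H y z t k ∧ H.perm d i = keyHead H y z t k ∧
            H'.perm d i = H.perm (t (colSlot k)) (c k)) ∨
         (i = c k ∧ H.perm d i = H.perm (t (colSlot k)) (c k) ∧
            H'.perm d i = oldHead H y z t k)) := by
  rw [hH' d]
  exact twist_cases ht hinj hc d i

lemma IsTwist.slotVertex_eq (hH' : IsTwist H y z t c H') (ht : IsGoodTuple H y z P t)
    (hinj : Function.Injective t) (hc : IsGoodShift H y z t c) :
    slotVertex H' y z = slotVertex H y z := by
  have hy : ∀ d, H'.perm d y = H.perm d y := by
    intro d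
    rcases hH'.cases ht hinj hc d y with ⟨-, e⟩ | ⟨k, hk, ⟨a, -⟩ | ⟨a, -⟩ | ⟨a, -⟩⟩
    · exact e
    · exact absurd a.symm (ht.ne_y _)
    · exact absurd a.symm (ht.oldTail_ne_y _)
    · exact absurd a.symm (hc.ne_y _)
  have hz : ∀ d, H'.perm d z = H.perm d z := by
    intro d
    rcases hH'.cases ht hinj hc d z with ⟨-, e⟩ | ⟨k, hk, ⟨a, -⟩ | ⟨a, -⟩ | ⟨a, -⟩⟩
    · exact e
    · exact absurd a.symm (ht.ne_z _)
    · exact absurd a.symm (ht.oldTail_ne_z _)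
    · exact absurd a.symm (hc.ne_z _)
  have hy' : ∀ d, (H'.perm d).symm y = (H.perm d).symm y := by
    intro d
    rw [Equiv.symm_apply_eq]
    have hi := Equiv.apply_symm_apply (H.perm d) y
    rcases hH'.cases ht hinj hc d ((H.perm d).symm y) with
      ⟨-, e⟩ | ⟨k, hk, ⟨-, a, -⟩ | ⟨-, a, -⟩ | ⟨-, a, -⟩⟩
    · exact (e.trans hi).symm
    · exact absurd (a.symm.trans hi) (ht.oldHead_ne_y _)
    · exact absurd (a.symm.trans hi) (ht.ne_y _)
    · exact absurd (a.symm.trans hi) (hc.head_ne_y _)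
  have hz' : ∀ d, (H'.perm d).symm z = (H.perm d).symm z := by
    intro d
    rw [Equiv.symm_apply_eq]
    have hi := Equiv.apply_symm_apply (H.perm d) z
    rcases hH'.cases ht hinj hc d ((H.perm d).symm z) with
      ⟨-, e⟩ | ⟨k, hk, ⟨-, a, -⟩ | ⟨-, a, -⟩ | ⟨-, a, -⟩⟩
    · exact (e.trans hi).symm
    · exact absurd (a.symm.trans hi) (ht.oldHead_ne_z _)
    · exact absurd (a.symm.trans hi) (ht.ne_z _)
    · exact absurd (a.symm.trans hi) (hc.head_ne_z _)
  funext j d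
  fin_cases j
  · exact hy d
  · exact hz' d
  · exact hy' d
  · exact hz d
  · exact hy d
  · exact hz d

lemma IsTwist.key_cases (hH' : IsTwist H y z t c H') (hP : ∀ i j, i ≠ j → Disjoint (P i) (P j))
    (ht : IsGoodTuple H y z P t) (hc : IsGoodShift H y z t c)
    {t' : Fin 6 → {d : Fin n // d ∈ D}} (ht' : ∀ j, (t' j : Fin n) ∈ P j) (k : Fin 4) :
    ((t' (colSlot k) = t (colSlot k) → t' (tailSlot k) ≠ t (tailSlot k)) ∧
      H'.perm (t' (colSlot k)) (slotVertex H y z (tailSlot k) (t' (tailSlot k))) =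
        H.perm (t' (colSlot k)) (slotVertex H y z (tailSlot k) (t' (tailSlot k)))) ∨
    (t' (colSlot k) = t (colSlot k) ∧ t' (tailSlot k) = t (tailSlot k) ∧
      H.perm (t' (colSlot k)) (slotVertex H y z (tailSlot k) (t' (tailSlot k))) ≠
        slotVertex H y z (headSlot k) (t' (headSlot k)) ∧
      H'.perm (t' (colSlot k)) (slotVertex H y z (tailSlot k) (t' (tailSlot k))) =
        slotVertex H y z (headSlot k) (t (headSlot k))) := by
  have hinj : Function.Injective t := fun i j h => slot_eq_of_mem hP ht.mem ht.mem h
  rcases hH'.cases ht hinj hc (t' (colSlot k)) (slotVertex H y z (tailSlot k) (t' (tailSlot k)))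
    with ⟨h, e⟩ | ⟨l, hl, h⟩
  · left
    refine ⟨fun hk hT => (h k hk).1 ?_, e⟩
    rw [hT]; rfl
  · obtain rfl : k = l := colSlot_injective (slot_eq_of_mem hP ht' ht.mem hl)
    rcases h with ⟨a1, a2, a3⟩ | ⟨a1, -, -⟩ | ⟨a1, -, -⟩
    · exact Or.inr ⟨hl, slotVertex_injective H y z _ a1, a2 ▸ ht.oldHead_notMem k _, a3⟩
    · exact absurd a1.symm (ht.oldTail_notMem k _)
    · exact absurd a1.symm (hc.notMem k _)

lemma IsTwist.eq_of_key_agree (hH' : IsTwist H y z t c H')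
    (hP : ∀ i j, i ≠ j → Disjoint (P i) (P j))
    (ht : IsGoodTuple H y z P t) (hc : IsGoodShift H y z t c)
    {t' : Fin 6 → {d : Fin n // d ∈ D}} (ht' : ∀ j, (t' j : Fin n) ∈ P j)
    (hkey' : ∀ k, H'.perm (t' (colSlot k)) (slotVertex H y z (tailSlot k) (t' (tailSlot k))) =
      slotVertex H y z (headSlot k) (t' (headSlot k)))
    (k₀ : Fin 4) (hk₀ : t' (colSlot k₀) = t (colSlot k₀) ∧ t' (tailSlot k₀) = t (tailSlot k₀)) :
    t' = t := by
  have hkc := fun k => hH'.key_cases hP ht hc ht' k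
  have hkct := fun k => hH'.key_cases hP ht hc ht.mem k
  have head : ∀ k, t' (colSlot k) = t (colSlot k) → t' (tailSlot k) = t (tailSlot k) →
      t' (headSlot k) = t (headSlot k) := by
    intro k h1 h2
    rcases hkc k with ⟨h, -⟩ | ⟨-, -, -, e⟩
    · exact absurd h2 (h h1)
    · exact slotVertex_injective H y z _ ((hkey' k).symm.trans e)
  have tail : ∀ k, t' (colSlot k) = t (colSlot k) → t' (headSlot k) = t (headSlot k) →
      t' (tailSlot k) = t (tailSlot k) := by
    intro k h1 h2
    rcases hkct k with ⟨h, -⟩ | ⟨-, -, -, e⟩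
    · exact absurd rfl (h rfl)
    · have e' := hkey' k
      rw [h1, h2, ← e] at e'
      exact slotVertex_injective H y z _ ((H'.perm _).injective e')
  have case1 : t' 0 = t 0 → t' 1 = t 1 → t' 4 = t 4 → t' 5 = t 5 → t' = t := by
    intro h0 h1 h4 h5
    suffices h : t' 2 = t 2 ∧ t' 3 = t 3 by
      funext j
      fin_cases j
      exacts [h0, h1, h.1, h.2, h4, h5]
    by_cases h2 : t' 2 = t 2
    · exact ⟨h2, head 2 h2 h4⟩
    by_cases h3 : t' 3 = t 3
    · exact ⟨tail 3 h3 h5, h3⟩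
    exfalso
    rcases hkc 2 with ⟨-, e2⟩ | ⟨h, -⟩
    swap
    · exact h2 h
    rcases hkc 3 with ⟨-, e3⟩ | ⟨h, -⟩
    swap
    · exact h3 h
    rw [hkey'] at e2 e3
    refine ht.no_completion₂₃ (t' 2) (t' 3) ?_ ?_
    · rw [← h4]; exact e2.symm
    · rw [← h5]; exact e3.symm
  have case2 : t' 2 = t 2 → t' 3 = t 3 → t' 4 = t 4 → t' 5 = t 5 → t' = t := by
    intro h2 h3 h4 h5
    suffices h : t' 0 = t 0 ∧ t' 1 = t 1 by
      funext j
      fin_cases j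
      exacts [h.1, h.2, h2, h3, h4, h5]
    by_cases h0 : t' 0 = t 0
    · exact ⟨h0, tail 0 h0 h5⟩
    by_cases h1 : t' 1 = t 1
    · exact ⟨head 1 h1 h4, h1⟩
    exfalso
    rcases hkc 0 with ⟨-, e0⟩ | ⟨h, -⟩
    swap
    · exact h0 h
    rcases hkc 1 with ⟨-, e1⟩ | ⟨h, -⟩
    swap
    · exact h1 h
    rw [hkey'] at e0 e1
    refine ht.no_completion₁₀ (t' 1) (t' 0) ?_ ?_
    · rw [← h4]; exact e1.symm
    · rw [← h5]; exact e0.symm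
  obtain ⟨hC, hT⟩ := hk₀
  have hH := head k₀ hC hT
  fin_cases k₀
  · exact case1 hC hT (tail 1 hT hC) hH
  · exact case1 hH hC hT (head 0 hH hC)
  · exact case2 hC hH hT (head 3 hH hC)
  · exact case2 hT hC (tail 2 hT hC) hH

lemma IsTwist.isBridgeTuple_iff (hH' : IsTwist H y z t c H')
    (hP : ∀ i j, i ≠ j → Disjoint (P i) (P j))
    (ht : IsGoodTuple H y z P t) (hc : IsGoodShift H y z t c)
    (t' : Fin 6 → {d : Fin n // d ∈ D}) :
    IsBridgeTuple H' y z P t' ↔ IsBridgeTuple H y z P t' ∨ t' = t := by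
  have hinj : Function.Injective t := fun i j h => slot_eq_of_mem hP ht.mem ht.mem h
  have hsv := hH'.slotVertex_eq ht hinj hc
  constructor
  · rintro ⟨h1, h2, h3, h4, h5⟩
    rw [hsv] at h2 h3 h4 h5
    by_cases hex : ∃ k, t' (colSlot k) = t (colSlot k) ∧ t' (tailSlot k) = t (tailSlot k)
    · obtain ⟨k, hk⟩ := hex
      exact Or.inr (hH'.eq_of_key_agree hP ht hc h1 h5 k hk)
    · push Not at hex
      refine Or.inl ⟨h1, h2, h3, h4, fun k => ?_⟩
      rcases hH'.key_cases hP ht hc h1 k with ⟨-, e⟩ | ⟨a, b, -⟩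
      · rw [← e]; exact h5 k
      · exact absurd b (hex k a)
  · rintro (⟨h1, h2, h3, h4, h5⟩ | rfl)
    · refine ⟨h1, by rwa [hsv], by rwa [hsv], by rwa [hsv], fun k => ?_⟩
      rw [hsv]
      rcases hH'.key_cases hP ht hc h1 k with ⟨-, e⟩ | ⟨-, -, h, -⟩
      · rw [e]; exact h5 k
      · exact absurd (h5 k) h
    · refine ⟨ht.mem, by rw [hsv]; exact ht.ne_y, by rw [hsv]; exact ht.ne_z,
        by rw [hsv]; exact ht.inj, fun k => ?_⟩
      rw [hsv]
      rcases hH'.key_cases hP ht hc ht.mem k with ⟨h, -⟩ | ⟨-, -, -, e⟩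
      · exact absurd rfl (h rfl)
      · exact e

lemma tupleVerts_congr (h : slotVertex H' y z = slotVertex H y z) :
    tupleVerts H' y z = tupleVerts H y z := by
  funext t
  simp only [tupleVerts, h]

lemma IsTwist.isBridge_iff (hH' : IsTwist H y z t c H') (hyz : y ≠ z)
    (hP : ∀ i j, i ≠ j → Disjoint (P i) (P j))
    (ht : IsGoodTuple H y z P t) (hc : IsGoodShift H y z t c) (w : Fin 6 → Fin n) :
    IsBridge H' y z P w ↔ IsBridge H y z P w ∨ w = tupleVerts H y z t := by
  have hinj : Function.Injective t := fun i j h => slot_eq_of_mem hP ht.mem ht.mem h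
  rw [isBridge_iff_exists_tuple H' hyz, isBridge_iff_exists_tuple H hyz,
    tupleVerts_congr (hH'.slotVertex_eq ht hinj hc)]
  simp only [hH'.isBridgeTuple_iff hP ht hc]
  constructor
  · rintro ⟨t', h | rfl, rfl⟩
    · exact Or.inl ⟨t', h, rfl⟩
    · exact Or.inr rfl
  · rintro (⟨t', h, rfl⟩ | rfl)
    · exact ⟨t', Or.inl h, rfl⟩
    · exact ⟨t, Or.inr rfl, rfl⟩

lemma IsGoodTuple.notMem_keyArcsOf (ht : IsGoodTuple H y z P t)
    (d : {d : Fin n // d ∈ D}) (i : Fin n) :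
    (i, H.1 d i) ∉ keyArcsOf (tupleVerts H y z t) := by
  intro h
  simp only [keyArcsOf, Finset.mem_insert, Finset.mem_singleton, Prod.mk.injEq] at h
  rcases h with ⟨rfl, h⟩ | ⟨rfl, h⟩ | ⟨rfl, h⟩ | ⟨rfl, h⟩
  · exact ht.key_notMem 1 d h
  · exact ht.key_notMem 2 d h
  · exact ht.key_notMem 3 d h
  · exact ht.key_notMem 0 d h

lemma IsBridge.exists_of_mem_bridgeArcsOf {w : Fin 6 → Fin n} (hw : IsBridge H y z P w)
    {p : Fin n × Fin n} (hp : p ∈ bridgeArcsOf y z w) : ∃ d, H.1 d p.1 = p.2 := by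
  obtain ⟨-, d₁, d₂, d₃, d₄, d₅, d₆, -, -, -, -, -, -, e1, e2, e3, e4, e5, e6, e7, e8, e9,
    e10⟩ := hw
  simp only [bridgeArcsOf, Finset.mem_insert, Finset.mem_singleton] at hp
  rcases hp with rfl | rfl | rfl | rfl | rfl | rfl | rfl | rfl | rfl | rfl
  exacts [⟨_, e1⟩, ⟨_, e3⟩, ⟨_, e6⟩, ⟨_, e8⟩, ⟨_, e5⟩, ⟨_, e7⟩, ⟨_, e2⟩, ⟨_, e4⟩, ⟨_, e9⟩,
    ⟨_, e10⟩]

lemma keyArcsOf_subset_bridgeArcsOf (y z : Fin n) (w : Fin 6 → Fin n) :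
    keyArcsOf w ⊆ bridgeArcsOf y z w := by
  intro p
  simp only [keyArcsOf, bridgeArcsOf, Finset.mem_insert, Finset.mem_singleton]
  tauto

lemma IsBridge.ne_of_mem_keyArcsOf {w : Fin 6 → Fin n} (hw : IsBridge H y z P w)
    {p : Fin n × Fin n} (hp : p ∈ keyArcsOf w) :
    p.1 ≠ y ∧ p.1 ≠ z ∧ p.2 ≠ y ∧ p.2 ≠ z := by
  have hnd := hw.1
  simp only [List.nodup_cons, List.mem_cons, List.not_mem_nil, or_false, not_or,
    List.nodup_nil, not_false_eq_true, and_true] at hnd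
  simp only [keyArcsOf, Finset.mem_insert, Finset.mem_singleton] at hp
  rcases hp with rfl | rfl | rfl | rfl <;> grind

lemma mem_keyArcsOf_of_mem_bridgeArcsOf {w : Fin 6 → Fin n} {p : Fin n × Fin n}
    (hp : p ∈ bridgeArcsOf y z w) (hne : p.1 ≠ y ∧ p.1 ≠ z ∧ p.2 ≠ y ∧ p.2 ≠ z) :
    p ∈ keyArcsOf w := by
  simp only [bridgeArcsOf, keyArcsOf, Finset.mem_insert, Finset.mem_singleton] at hp ⊢
  grind

lemma IsTwist.isDistinguishableBridge_iff (hH' : IsTwist H y z t c H') (hyz : y ≠ z)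
    (hP : ∀ i j, i ≠ j → Disjoint (P i) (P j))
    (ht : IsGoodTuple H y z P t) (hc : IsGoodShift H y z t c) (w : Fin 6 → Fin n) :
    IsDistinguishableBridge H' y z P w ↔
      IsDistinguishableBridge H y z P w ∨ w = tupleVerts H y z t := by
  have hb := hH'.isBridge_iff hyz hP ht hc
  set w₀ := tupleVerts H y z t with hw₀
  have key : ∀ w', IsBridge H y z P w' → Disjoint (keyArcsOf w₀) (bridgeArcsOf y z w') := by
    intro w' hw'
    rw [Finset.disjoint_left]
    rintro ⟨i, j⟩ hp hp'
    obtain ⟨d, hd⟩ := hw'.exists_of_mem_bridgeArcsOf hp'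
    simp only at hd
    subst hd
    exact ht.notMem_keyArcsOf d i hp
  have key' : ∀ w', IsBridge H y z P w' → Disjoint (keyArcsOf w') (bridgeArcsOf y z w₀) := by
    intro w' hw'
    rw [Finset.disjoint_left]
    intro p hp hp'
    exact Finset.disjoint_left.1 (key w' hw')
      (mem_keyArcsOf_of_mem_bridgeArcsOf hp' (hw'.ne_of_mem_keyArcsOf hp))
      (keyArcsOf_subset_bridgeArcsOf y z w' hp)
  constructor
  · rintro ⟨h1, h2⟩
    rcases (hb w).1 h1 with h | h
    · exact Or.inl ⟨h, fun w' hw' => h2 w' ((hb w').2 (Or.inl hw'))⟩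
    · exact Or.inr h
  · rintro (⟨h1, h2⟩ | rfl)
    · refine ⟨(hb w).2 (Or.inl h1), fun w' hw' hd => ?_⟩
      rcases (hb w').1 hw' with h | rfl
      · exact h2 w' h hd
      · exact absurd (key' w h1) hd
    · refine ⟨(hb _).2 (Or.inr rfl), fun w' hw' hd => ?_⟩
      rcases (hb w').1 hw' with h | h
      · exact absurd (key w' h) hd
      · exact h

lemma IsTwist.distBridgeCount_eq (hH' : IsTwist H y z t c H') (hyz : y ≠ z)
    (hP : ∀ i j, i ≠ j → Disjoint (P i) (P j))
    (ht : IsGoodTuple H y z P t) (hc : IsGoodShift H y z t c) :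
    distBridgeCount H' y z P = distBridgeCount H y z P + 1 := by
  have hnot : tupleVerts H y z t ∉ {w | IsDistinguishableBridge H y z P w} := by
    intro (h : IsDistinguishableBridge H y z P _)
    have hm : (tupleVerts H y z t 1, tupleVerts H y z t 0) ∈ keyArcsOf (tupleVerts H y z t) := by
      simp [keyArcsOf]
    obtain ⟨d, hd⟩ := h.1.exists_of_mem_bridgeArcsOf (keyArcsOf_subset_bridgeArcsOf y z _ hm)
    simp only at hd
    rw [← hd] at hm
    exact ht.notMem_keyArcsOf d _ hm
  have hset : {w | IsDistinguishableBridge H' y z P w} =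
      insert (tupleVerts H y z t) {w | IsDistinguishableBridge H y z P w} := by
    ext w
    simp only [Set.mem_ofPred_eq, Set.mem_insert_iff,
      hH'.isDistinguishableBridge_iff hyz hP ht hc w, or_comm]
  change Set.ncard {w | IsDistinguishableBridge H' y z P w} =
    Set.ncard {w | IsDistinguishableBridge H y z P w} + 1
  rw [hset, Set.ncard_insert_of_notMem hnot (Set.toFinite _)]

lemma IsTwist.eArcs_le (hH' : IsTwist H y z t c H') (hinj : Function.Injective t)
    (ht : IsGoodTuple H y z P t) (hc : IsGoodShift H y z t c) (A₁ A₂ : Finset (Fin n)) :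
    eArcs H' A₁ A₂ ≤ eArcs H A₁ A₂ + 12 := by
  let tails : Fin 4 → Fin 3 → Fin n := fun k => ![keyTail H y z t k, oldTail H y z t k, c k]
  let S : Finset ({d : Fin n // d ∈ D} × Fin n) :=
    Finset.univ.image fun x : Fin 4 × Fin 3 => (t (colSlot x.1), tails x.1 x.2)
  have hS : S.card ≤ 12 := Finset.card_image_le.trans (by simp)
  have hsub : {p : {d : Fin n // d ∈ D} × Fin n | p.2 ∈ A₁ ∧ H'.1 p.1 p.2 ∈ A₂} ⊆
      {p | p.2 ∈ A₁ ∧ H.1 p.1 p.2 ∈ A₂} ∪ (S : Set ({d : Fin n // d ∈ D} × Fin n)) := by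
    rintro ⟨d, i⟩ ⟨h1, h2⟩
    rcases hH'.cases ht hinj hc d i with ⟨-, e⟩ | ⟨k, rfl, ⟨a, -⟩ | ⟨a, -⟩ | ⟨a, -⟩⟩
    · left
      refine ⟨h1, ?_⟩
      have e' : H'.1 d i = H.1 d i := e
      simp only at h2 ⊢
      rwa [← e']
    all_goals right; subst a
    · exact Finset.mem_coe.2 (Finset.mem_image.2 ⟨(k, 0), Finset.mem_univ _, rfl⟩)
    · exact Finset.mem_coe.2 (Finset.mem_image.2 ⟨(k, 1), Finset.mem_univ _, rfl⟩)
    · exact Finset.mem_coe.2 (Finset.mem_image.2 ⟨(k, 2), Finset.mem_univ _, rfl⟩)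
  have h1 := Set.ncard_le_ncard hsub (Set.toFinite _)
  have h2 := Set.ncard_union_le {p | p.2 ∈ A₁ ∧ H.1 p.1 p.2 ∈ A₂}
    (S : Set ({d : Fin n // d ∈ D} × Fin n))
  rw [Set.ncard_coe_finset] at h2
  change Set.ncard {p : {d : Fin n // d ∈ D} × Fin n | p.2 ∈ A₁ ∧ H'.1 p.1 p.2 ∈ A₂} ≤
    Set.ncard {p : {d : Fin n // d ∈ D} × Fin n | p.2 ∈ A₁ ∧ H.1 p.1 p.2 ∈ A₂} + 12
  omega

lemma IsTwist.eq_of_eq {H₁ H₂ : GD n D} {t₁ t₂ : Fin 6 → {d : Fin n // d ∈ D}}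
    (h₁ : IsTwist H₁ y z t₁ c H') (h₂ : IsTwist H₂ y z t₂ c H')
    (hs₁ : slotVertex H' y z = slotVertex H₁ y z) (hs₂ : slotVertex H' y z = slotVertex H₂ y z)
    (hw : tupleVerts H₁ y z t₁ = tupleVerts H₂ y z t₂)
    (ho : oldTail H₁ y z t₁ = oldTail H₂ y z t₂) : H₁ = H₂ ∧ t₁ = t₂ := by
  have ht : t₁ = t₂ := by
    rw [← tupleVerts_congr hs₁, ← tupleVerts_congr hs₂] at hw
    exact tupleVerts_injective H' y z hw
  subst ht
  refine ⟨GD.ext_perm fun d => ?_, rfl⟩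
  have hk : keyTail H₁ y z t₁ = keyTail H₂ y z t₁ := by
    funext k
    simp only [keyTail, ← hs₁, ← hs₂]
  have h := (h₁ d).symm.trans (h₂ d)
  rw [hk, ho] at h
  exact mul_right_cancel h

lemma exists_finset_of_pair_events {ε α : Type} [Fintype ε] {m : ℕ} (Q : Fin m → Finset α) {K : ℕ}
    (hK : ∀ l, (Q l).card ≤ K) (i j : ε → Fin m) (hij : ∀ e, i e ≠ j e)
    (R : ε → α → α → Prop) {β : ℕ}
    (hR : ∀ e, ∃ S : Finset (α × α), S.card ≤ β ∧
      ∀ a ∈ Q (i e), ∀ b ∈ Q (j e), R e a b → (a, b) ∈ S) :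
    ∃ B : Finset (Fin m → α), B.card ≤ Fintype.card ε * (β * K ^ (m - 2)) ∧
      ∀ t, (∀ l, t l ∈ Q l) → (∃ e, R e (t (i e)) (t (j e))) → t ∈ B := by
  choose S hS hmem using hR
  let box : ε → α × α → Finset (Fin m → α) := fun e p =>
    Fintype.piFinset fun l => if l = i e then {p.1} else if l = j e then {p.2} else Q l
  have hbox : ∀ e p, (box e p).card ≤ K ^ (m - 2) := by
    intro e p
    rw [Fintype.card_piFinset]
    calc ∏ l, (if l = i e then {p.1} else if l = j e then {p.2} else Q l : Finset α).card
        ≤ ∏ l, if l ∈ ({i e, j e} : Finset (Fin m)) then 1 else K := by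
          refine Finset.prod_le_prod' fun l _ => ?_
          by_cases h1 : l = i e
          · simp [h1]
          by_cases h2 : l = j e
          · simp [h2, (hij e).symm]
          simpa [h1, h2] using hK l
      _ = K ^ (m - 2) := by
          rw [Finset.prod_ite]
          have h : (Finset.univ.filter fun l => l ∉ ({i e, j e} : Finset (Fin m))) =
              ({i e, j e} : Finset (Fin m))ᶜ := by ext; simp
          rw [Finset.prod_const_one, one_mul, Finset.prod_const, h, Finset.card_compl,
            Finset.card_pair (hij e), Fintype.card_fin]
  refine ⟨Finset.univ.biUnion fun e => (S e).biUnion (box e), ?_, ?_⟩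
  · refine Finset.card_biUnion_le_card_mul _ _ _ fun e _ => ?_
    exact (Finset.card_biUnion_le_card_mul _ _ _ fun p _ => hbox e p).trans
      (Nat.mul_le_mul_right _ (hS e))
  · rintro t ht ⟨e, he⟩
    simp only [Finset.mem_biUnion, Finset.mem_univ, true_and]
    refine ⟨e, (t (i e), t (j e)), hmem e _ (ht _) _ (ht _) he, ?_⟩
    rw [Fintype.mem_piFinset]
    intro l
    by_cases h1 : l = i e
    · simp [h1]
    by_cases h2 : l = j e
    · simp [h2, (hij e).symm]
    simpa [h1, h2] using ht l

lemma exists_finset_of_functional {α : Type} (A B : Finset α) (R : α → α → Prop)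
    (hR : ∀ a b b', R a b → R a b' → b = b') :
    ∃ S : Finset (α × α), S.card ≤ A.card ∧ ∀ a ∈ A, ∀ b ∈ B, R a b → (a, b) ∈ S := by
  refine ⟨(A ×ˢ B).filter fun p => R p.1 p.2, ?_, ?_⟩
  · refine Finset.card_le_card_of_injOn Prod.fst ?_ ?_
    · intro p hp
      exact (Finset.mem_product.1 (Finset.mem_filter.1 hp).1).1
    · rintro ⟨a, b⟩ hp ⟨a', b'⟩ hp' (rfl : a = a')
      rw [hR a b b' (Finset.mem_filter.1 hp).2 (Finset.mem_filter.1 hp').2]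
  · intro a ha b hb h
    exact Finset.mem_filter.2 ⟨Finset.mem_product.2 ⟨ha, hb⟩, h⟩

lemma exists_finset_card_le_eArcs (H : GD n D) (A₁ A₂ : Finset (Fin n))
    (R : {d : Fin n // d ∈ D} → {d : Fin n // d ∈ D} → Prop)
    (Q : {d : Fin n // d ∈ D} → Fin n → {d : Fin n // d ∈ D} → {d : Fin n // d ∈ D} → Prop)
    (h₁ : ∀ a b, R a b → ∃ d i, i ∈ A₁ ∧ H.perm d i ∈ A₂ ∧ Q d i a b)
    (h₂ : ∀ d i a b a' b', Q d i a b → Q d i a' b' → a = a' ∧ b = b') :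
    ∃ S : Finset ({d : Fin n // d ∈ D} × {d : Fin n // d ∈ D}), S.card ≤ eArcs H A₁ A₂ ∧
      ∀ a b, R a b → (a, b) ∈ S := by
  refine ⟨Finset.univ.filter fun p => R p.1 p.2, ?_, fun a b h => by simpa using h⟩
  have h₁' : ∀ p : {d : Fin n // d ∈ D} × {d : Fin n // d ∈ D}, ∃ d i,
      R p.1 p.2 → i ∈ A₁ ∧ H.perm d i ∈ A₂ ∧ Q d i p.1 p.2 := by
    intro p
    by_cases hp : R p.1 p.2
    · obtain ⟨d, i, h⟩ := h₁ _ _ hp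
      exact ⟨d, i, fun _ => h⟩
    · exact ⟨p.1, p.1, fun h => absurd h hp⟩
  choose f g h using h₁'
  let arcs : Finset ({d : Fin n // d ∈ D} × Fin n) :=
    Finset.univ.filter fun p => p.2 ∈ A₁ ∧ H.1 p.1 p.2 ∈ A₂
  have harcs : eArcs H A₁ A₂ = arcs.card := by
    rw [eArcs, Nat.card_eq_fintype_card, Fintype.card_subtype]
  rw [harcs]
  refine Finset.card_le_card_of_injOn (fun p => (f p, g p)) ?_ ?_
  · intro p hp
    have hp' := h p (Finset.mem_filter.1 hp).2
    exact Finset.mem_filter.2 ⟨Finset.mem_univ _, hp'.1, hp'.2.1⟩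
  · rintro ⟨a, b⟩ hp ⟨a', b'⟩ hp' he
    have hq := (h (a, b) (Finset.mem_filter.1 hp).2).2.2
    have hq' := (h (a', b') (Finset.mem_filter.1 hp').2).2.2
    simp only [Prod.mk.injEq] at he
    rw [← he.1, ← he.2] at hq'
    obtain ⟨rfl, rfl⟩ := h₂ _ _ _ _ _ _ hq hq'
    rfl

/-- All good tuples for `H`. -/
def goodTuples (H : GD n D) (y z : Fin n) (P : Fin 6 → Finset (Fin n)) :
    Finset (Fin 6 → {d : Fin n // d ∈ D}) :=
  Finset.univ.filter fun t => IsGoodTuple H y z P t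

/-- All third tails for a twist of `H` along `t`. -/
def goodShifts (H : GD n D) (y z : Fin n) (t : Fin 6 → {d : Fin n // d ∈ D}) :
    Finset (Fin 4 → Fin n) :=
  Finset.univ.filter fun c => IsGoodShift H y z t c

lemma prod_card_le_goodTuples (H : GD n D) (y z : Fin n) (P : Fin 6 → Finset (Fin n))
    (hPD : ∀ j, P j ⊆ D) {K E : ℕ} (hK : ∀ j, (P j).card ≤ K)
    (hE : ∀ A₁ A₂ : Finset (Fin n), A₁.card = D.card → A₂.card = D.card → eArcs H A₁ A₂ ≤ E) :
    ∏ j, (P j).card ≤ (goodTuples H y z P).card + 58 * (K * K ^ 4) + 14 * (E * K ^ 4) := by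
  let Q : Fin 6 → Finset {d : Fin n // d ∈ D} := fun j => (P j).subtype (· ∈ D)
  have hQcard : ∀ j, (Q j).card = (P j).card := by
    intro j
    rw [Finset.card_subtype, Finset.filter_true_of_mem fun d hd => hPD j hd]
  have hQK : ∀ j, (Q j).card ≤ K := fun j => (hQcard j).trans_le (hK j)
  have small : ∀ {ε : Type} [Fintype ε] (i j : ε → Fin 6) (_ : ∀ e, i e ≠ j e)
      (R : ε → {d : Fin n // d ∈ D} → {d : Fin n // d ∈ D} → Prop)
      (_ : ∀ e a b b', R e a b → R e a b' → b = b'),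
      ∃ B : Finset (Fin 6 → {d : Fin n // d ∈ D}), B.card ≤ Fintype.card ε * (K * K ^ 4) ∧
        ∀ t, (∀ l, t l ∈ Q l) → (∃ e, R e (t (i e)) (t (j e))) → t ∈ B := by
    intro ε _ i j hij R hR
    refine exists_finset_of_pair_events Q hQK i j hij R fun e => ?_
    obtain ⟨S, hS, h⟩ := exists_finset_of_functional (Q (i e)) (Q (j e)) (R e) (hR e)
    exact ⟨S, hS.trans (hQK _), h⟩
  have nbhd : ∀ j, (Finset.univ.image (slotVertex H y z j)).card = D.card := by
    intro j
    rw [Finset.card_image_of_injective _ (slotVertex_injective H y z j), Finset.card_univ,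
      Fintype.card_coe]
  have large : ∀ {ε : Type} [Fintype ε] (i j : ε → Fin 6) (_ : ∀ e, i e ≠ j e)
      (R : ε → {d : Fin n // d ∈ D} → {d : Fin n // d ∈ D} → Prop) (r s : ε → Fin 6)
      (T : ε → {d : Fin n // d ∈ D} → Fin n → {d : Fin n // d ∈ D} → {d : Fin n // d ∈ D} → Prop)
      (_ : ∀ e a b, R e a b → ∃ d i, (∃ d', slotVertex H y z (r e) d' = i) ∧
        (∃ d', slotVertex H y z (s e) d' = H.perm d i) ∧ T e d i a b)
      (_ : ∀ e d i a b a' b', T e d i a b → T e d i a' b' → a = a' ∧ b = b'),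
      ∃ B : Finset (Fin 6 → {d : Fin n // d ∈ D}), B.card ≤ Fintype.card ε * (E * K ^ 4) ∧
        ∀ t, (∀ l, t l ∈ Q l) → (∃ e, R e (t (i e)) (t (j e))) → t ∈ B := by
    intro ε _ i j hij R r s T h1 h2
    refine exists_finset_of_pair_events Q hQK i j hij R fun e => ?_
    obtain ⟨S, hS, h⟩ := exists_finset_card_le_eArcs H (Finset.univ.image (slotVertex H y z (r e)))
      (Finset.univ.image (slotVertex H y z (s e))) (R e) (T e)
      (by simpa only [Finset.mem_image, Finset.mem_univ, true_and] using h1 e) (h2 e)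
    exact ⟨S, hS.trans (hE _ _ (nbhd _) (nbhd _)), fun a _ b _ => h a b⟩
  have svinj := slotVertex_injective H y z
  let v : Bool → Fin n := fun b => if b then y else z
  obtain ⟨B₁, hB₁, m₁⟩ := small (ε := Fin 6 × Bool) (fun e => e.1 + 1) (fun e => e.1)
    (fun e => by simp) (fun e _ d => slotVertex H y z e.1 d = v e.2)
    (fun e a b b' h h' => svinj _ (h.trans h'.symm))
  obtain ⟨B₂, hB₂, m₂⟩ := small (ε := {p : Fin 6 × Fin 6 // p.1 ≠ p.2}) (fun e => e.1.1)
    (fun e => e.1.2) (fun e => e.2) (fun e a b => slotVertex H y z e.1.1 a = slotVertex H y z e.1.2 b)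
    (fun e a b b' h h' => svinj _ (h.symm.trans h'))
  obtain ⟨B₃, hB₃, m₃⟩ := small (ε := Fin 4 × Bool) (fun e => colSlot e.1) (fun e => tailSlot e.1)
    (fun e => colSlot_ne_tailSlot _)
    (fun e q d => H.perm q (slotVertex H y z (tailSlot e.1) d) = v e.2)
    (fun e a b b' h h' => svinj _ ((H.perm a).injective (h.trans h'.symm)))
  obtain ⟨B₄, hB₄, m₄⟩ := small (ε := Fin 4 × Bool) (fun e => colSlot e.1) (fun e => headSlot e.1)
    (fun e => colSlot_ne_headSlot _)
    (fun e q d => (H.perm q).symm (slotVertex H y z (headSlot e.1) d) = v e.2)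
    (fun e a b b' h h' => svinj _ ((H.perm a).symm.injective (h.trans h'.symm)))
  obtain ⟨B₅, hB₅, m₅⟩ := large (ε := Fin 4) tailSlot headSlot tailSlot_ne_headSlot
    (fun k a b => ∃ q, H.perm q (slotVertex H y z (tailSlot k) a) =
      slotVertex H y z (headSlot k) b) tailSlot headSlot
    (fun k q i a b => i = slotVertex H y z (tailSlot k) a ∧
      H.perm q i = slotVertex H y z (headSlot k) b)
    (fun k a b ⟨q, hq⟩ => ⟨q, _, ⟨a, rfl⟩, ⟨b, hq.symm⟩, rfl, hq⟩)
    (fun k q i a b a' b' h h' => ⟨svinj _ (h.1.symm.trans h'.1), svinj _ (h.2.symm.trans h'.2)⟩)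
  obtain ⟨B₆, hB₆, m₆⟩ := large (ε := Fin 4) colSlot tailSlot colSlot_ne_tailSlot
    (fun k q a => ∃ d, H.perm q (slotVertex H y z (tailSlot k) a) =
      slotVertex H y z (headSlot k) d) tailSlot headSlot
    (fun k q i q' a => q' = q ∧ i = slotVertex H y z (tailSlot k) a)
    (fun k q a ⟨d, hd⟩ => ⟨q, _, ⟨a, rfl⟩, ⟨d, hd.symm⟩, rfl, rfl⟩)
    (fun k q i a b a' b' h h' => ⟨h.1.trans h'.1.symm, svinj _ (h.2.symm.trans h'.2)⟩)
  obtain ⟨B₇, hB₇, m₇⟩ := large (ε := Fin 4) colSlot headSlot colSlot_ne_headSlot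
    (fun k q b => ∃ d, (H.perm q).symm (slotVertex H y z (headSlot k) b) =
      slotVertex H y z (tailSlot k) d) tailSlot headSlot
    (fun k q i q' b => q' = q ∧ H.perm q i = slotVertex H y z (headSlot k) b)
    (fun k q b ⟨d, hd⟩ => ⟨q, _, ⟨d, rfl⟩,
      ⟨b, by rw [← hd, Equiv.apply_symm_apply]⟩, rfl, by rw [← hd, Equiv.apply_symm_apply]⟩)
    (fun k q i a b a' b' h h' => ⟨h.1.trans h'.1.symm, svinj _ (h.2.symm.trans h'.2)⟩)
  obtain ⟨B₈, hB₈, m₈⟩ := large (ε := Unit) (fun _ => 4) (fun _ => 5) (fun _ => by decide)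
    (fun _ a b => ∃ p q, H.perm p (slotVertex H y z 4 a) = slotVertex H y z 3 q ∧
      H.perm q (slotVertex H y z 2 p) = slotVertex H y z 5 b) (fun _ => 4) (fun _ => 3)
    (fun _ p i a b => i = slotVertex H y z 4 a ∧ ∃ q, H.perm p i = slotVertex H y z 3 q ∧
      H.perm q (slotVertex H y z 2 p) = slotVertex H y z 5 b)
    (fun _ a b ⟨p, q, h, h'⟩ => ⟨p, _, ⟨a, rfl⟩, ⟨q, h.symm⟩, rfl, q, h, h'⟩)
    (by
      rintro - p i a b a' b' ⟨h1, q, h2, h3⟩ ⟨h1', q', h2', h3'⟩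
      obtain rfl := svinj _ (h2.symm.trans h2')
      exact ⟨svinj _ (h1.symm.trans h1'), svinj _ (h3.symm.trans h3')⟩)
  obtain ⟨B₉, hB₉, m₉⟩ := large (ε := Unit) (fun _ => 4) (fun _ => 5) (fun _ => by decide)
    (fun _ a b => ∃ p q, H.perm p (slotVertex H y z 4 a) = slotVertex H y z 0 q ∧
      H.perm q (slotVertex H y z 1 p) = slotVertex H y z 5 b) (fun _ => 4) (fun _ => 0)
    (fun _ p i a b => i = slotVertex H y z 4 a ∧ ∃ q, H.perm p i = slotVertex H y z 0 q ∧
      H.perm q (slotVertex H y z 1 p) = slotVertex H y z 5 b)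
    (fun _ a b ⟨p, q, h, h'⟩ => ⟨p, _, ⟨a, rfl⟩, ⟨q, h.symm⟩, rfl, q, h, h'⟩)
    (by
      rintro - p i a b a' b' ⟨h1, q, h2, h3⟩ ⟨h1', q', h2', h3'⟩
      obtain rfl := svinj _ (h2.symm.trans h2')
      exact ⟨svinj _ (h1.symm.trans h1'), svinj _ (h3.symm.trans h3')⟩)
  have hcover : Fintype.piFinset Q ⊆
      goodTuples H y z P ∪ B₁ ∪ B₂ ∪ B₃ ∪ B₄ ∪ B₅ ∪ B₆ ∪ B₇ ∪ B₈ ∪ B₉ := by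
    intro t ht
    have htQ : ∀ l, t l ∈ Q l := Fintype.mem_piFinset.1 ht
    by_contra hcon
    simp only [Finset.mem_union, not_or] at hcon
    obtain ⟨⟨⟨⟨⟨⟨⟨⟨⟨hg, n₁⟩, n₂⟩, n₃⟩, n₄⟩, n₅⟩, n₆⟩, n₇⟩, n₈⟩, n₉⟩ := hcon
    refine hg (Finset.mem_filter.2 ⟨Finset.mem_univ _, ?_⟩)
    exact {
      mem := fun j => Finset.mem_subtype.1 (htQ j)
      ne_y := fun j h => n₁ (m₁ t htQ ⟨(j, true), h⟩)
      ne_z := fun j h => n₁ (m₁ t htQ ⟨(j, false), h⟩)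
      inj := fun i j hij h => n₂ (m₂ t htQ ⟨⟨(i, j), hij⟩, h⟩)
      key_notMem := fun k q h => n₅ (m₅ t htQ ⟨k, q, h⟩)
      oldHead_ne_y := fun k h => n₃ (m₃ t htQ ⟨(k, true), h⟩)
      oldHead_ne_z := fun k h => n₃ (m₃ t htQ ⟨(k, false), h⟩)
      oldTail_ne_y := fun k h => n₄ (m₄ t htQ ⟨(k, true), h⟩)
      oldTail_ne_z := fun k h => n₄ (m₄ t htQ ⟨(k, false), h⟩)
      oldHead_notMem := fun k d h => n₆ (m₆ t htQ ⟨k, d, h⟩)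
      oldTail_notMem := fun k d h => n₇ (m₇ t htQ ⟨k, d, h⟩)
      no_completion₂₃ := fun p q h h' => n₈ (m₈ t htQ ⟨(), p, q, h, h'⟩)
      no_completion₁₀ := fun p q h h' => n₉ (m₉ t htQ ⟨(), p, q, h, h'⟩) }
  have hcard := Finset.card_le_card hcover
  rw [Fintype.card_piFinset, Finset.prod_congr rfl fun j _ => hQcard j] at hcard
  have u₁ := Finset.card_union_le (goodTuples H y z P) B₁
  have u₂ := Finset.card_union_le (goodTuples H y z P ∪ B₁) B₂
  have u₃ := Finset.card_union_le (goodTuples H y z P ∪ B₁ ∪ B₂) B₃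
  have u₄ := Finset.card_union_le (goodTuples H y z P ∪ B₁ ∪ B₂ ∪ B₃) B₄
  have u₅ := Finset.card_union_le (goodTuples H y z P ∪ B₁ ∪ B₂ ∪ B₃ ∪ B₄) B₅
  have u₆ := Finset.card_union_le (goodTuples H y z P ∪ B₁ ∪ B₂ ∪ B₃ ∪ B₄ ∪ B₅) B₆
  have u₇ := Finset.card_union_le (goodTuples H y z P ∪ B₁ ∪ B₂ ∪ B₃ ∪ B₄ ∪ B₅ ∪ B₆) B₇
  have u₈ := Finset.card_union_le (goodTuples H y z P ∪ B₁ ∪ B₂ ∪ B₃ ∪ B₄ ∪ B₅ ∪ B₆ ∪ B₇) B₈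
  have u₉ := Finset.card_union_le
    (goodTuples H y z P ∪ B₁ ∪ B₂ ∪ B₃ ∪ B₄ ∪ B₅ ∪ B₆ ∪ B₇ ∪ B₈) B₉
  have c₁ : Fintype.card (Fin 6 × Bool) = 12 := by simp
  have c₂ : Fintype.card {p : Fin 6 × Fin 6 // p.1 ≠ p.2} = 30 := by
    rw [Fintype.card_subtype]; decide
  have c₃ : Fintype.card (Fin 4 × Bool) = 8 := by simp
  rw [c₁] at hB₁
  rw [c₂] at hB₂
  rw [c₃] at hB₃ hB₄
  rw [Fintype.card_fin] at hB₅ hB₆ hB₇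
  rw [Fintype.card_unit] at hB₈ hB₉
  omega

lemma pow_le_goodShifts (H : GD n D) (y z : Fin n) (t : Fin 6 → {d : Fin n // d ∈ D}) :
    (n - (3 * D.card + 20)) ^ 4 ≤ (goodShifts H y z t).card + 24 * (n * n ^ 2) := by
  let f : Fin 4 → Equiv.Perm (Fin n) := fun k => H.perm (t (colSlot k))
  let vertices : Finset (Fin n) := Finset.univ.image fun j => slotVertex H y z j (t j)
  let bad : Fin 4 → Finset (Fin n) := fun k =>
    {y, z} ∪ ({y, z} : Finset (Fin n)).image (f k).symm ∪
      Finset.univ.image (slotVertex H y z (tailSlot k)) ∪ vertices ∪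
      Finset.univ.image (oldTail H y z t) ∪ vertices.image (f k).symm ∪
      Finset.univ.image (fun q => (H.perm q).symm (oldHead H y z t k)) ∪
      Finset.univ.image (fun q => (f k).symm (H.perm q (oldTail H y z t k)))
  have hbad : ∀ k, (bad k).card ≤ 3 * D.card + 20 := by
    intro k
    have hv : vertices.card ≤ 6 := Finset.card_image_le.trans (by simp)
    have hD : (Finset.univ : Finset {d : Fin n // d ∈ D}).card = D.card := by simp
    have h4 : (Finset.univ : Finset (Fin 4)).card = 4 := by simp
    have p1 : ({y, z} : Finset (Fin n)).card ≤ 2 := Finset.card_le_two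
    have p2 := (Finset.card_image_le (s := ({y, z} : Finset (Fin n))) (f := (f k).symm)).trans p1
    have p3 := hD ▸ Finset.card_image_le (s := Finset.univ)
      (f := slotVertex H y z (tailSlot k))
    have p4 := h4 ▸ Finset.card_image_le (s := Finset.univ) (f := oldTail H y z t)
    have p5 := (Finset.card_image_le (s := vertices) (f := (f k).symm)).trans hv
    have p6 := hD ▸ Finset.card_image_le (s := Finset.univ)
      (f := fun q => (H.perm q).symm (oldHead H y z t k))
    have p7 := hD ▸ Finset.card_image_le (s := Finset.univ)
      (f := fun q => (f k).symm (H.perm q (oldTail H y z t k)))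
    simp only [bad]
    refine (Finset.card_union_le _ _).trans ?_
    refine (Nat.add_le_add_right (Finset.card_union_le _ _) _).trans ?_
    refine (Nat.add_le_add_right (Nat.add_le_add_right (Finset.card_union_le _ _) _) _).trans ?_
    refine (Nat.add_le_add_right (Nat.add_le_add_right (Nat.add_le_add_right
      (Finset.card_union_le _ _) _) _) _).trans ?_
    refine (Nat.add_le_add_right (Nat.add_le_add_right (Nat.add_le_add_right
      (Nat.add_le_add_right (Finset.card_union_le _ _) _) _) _) _).trans ?_
    refine (Nat.add_le_add_right (Nat.add_le_add_right (Nat.add_le_add_right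
      (Nat.add_le_add_right (Nat.add_le_add_right (Finset.card_union_le _ _) _) _) _) _) _).trans ?_
    refine (Nat.add_le_add_right (Nat.add_le_add_right (Nat.add_le_add_right
      (Nat.add_le_add_right (Nat.add_le_add_right (Nat.add_le_add_right
        (Finset.card_union_le _ _) _) _) _) _) _) _).trans ?_
    omega
  let Q : Fin 4 → Finset (Fin n) := fun k => (bad k)ᶜ
  have hQ : ∀ k, n - (3 * D.card + 20) ≤ (Q k).card := by
    intro k
    have := hbad k
    simp only [Q, Finset.card_compl, Fintype.card_fin]
    omega
  have hQn : ∀ k, (Q k).card ≤ n := fun k => (Finset.card_le_univ _).trans_eq (Fintype.card_fin n)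
  have pairs : ∀ (g : Fin 4 → Equiv.Perm (Fin n)),
      ∃ B : Finset (Fin 4 → Fin n), B.card ≤ 12 * (n * n ^ 2) ∧
        ∀ c, (∀ l, c l ∈ Q l) → (∃ k l, k ≠ l ∧ g k (c k) = g l (c l)) → c ∈ B := by
    intro g
    obtain ⟨B, hB, h⟩ := exists_finset_of_pair_events Q hQn
      (fun e : {p : Fin 4 × Fin 4 // p.1 ≠ p.2} => e.1.1) (fun e => e.1.2) (fun e => e.2)
      (fun e a b => g e.1.1 a = g e.1.2 b) (β := n) (fun e => by
        obtain ⟨S, hS, h⟩ := exists_finset_of_functional (Q e.1.1) (Q e.1.2)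
          (fun a b => g e.1.1 a = g e.1.2 b)
          (fun a b b' h h' => (g e.1.2).injective (h.symm.trans h'))
        exact ⟨S, hS.trans (hQn _), h⟩)
    have hε : Fintype.card {p : Fin 4 × Fin 4 // p.1 ≠ p.2} = 12 := by
      rw [Fintype.card_subtype]; decide
    rw [hε] at hB
    exact ⟨B, hB, fun c hc ⟨k, l, hkl, hg⟩ => h c hc ⟨⟨(k, l), hkl⟩, hg⟩⟩
  obtain ⟨B₁, hB₁, m₁⟩ := pairs fun _ => 1
  obtain ⟨B₂, hB₂, m₂⟩ := pairs f
  have hcover : Fintype.piFinset Q ⊆ goodShifts H y z t ∪ B₁ ∪ B₂ := by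
    intro c hc
    have hcQ : ∀ l, c l ∈ Q l := Fintype.mem_piFinset.1 hc
    by_contra hcon
    simp only [Finset.mem_union, not_or] at hcon
    obtain ⟨⟨hg, n₁⟩, n₂⟩ := hcon
    refine hg (Finset.mem_filter.2 ⟨Finset.mem_univ _, ?_⟩)
    have hcb : ∀ k, c k ∉ bad k := fun k => Finset.mem_compl.1 (hcQ k)
    simp only [bad, vertices, Finset.mem_union, Finset.mem_insert, Finset.mem_singleton,
      Finset.mem_image, Finset.mem_univ, true_and, not_or, not_exists, Equiv.symm_apply_eq,
      exists_eq_or_imp, exists_eq_left, exists_exists_eq_and] at hcb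
    exact {
      ne_y := by grind
      ne_z := by grind
      head_ne_y := by grind
      head_ne_z := by grind
      notMem := by grind
      ne_vertex := by grind
      ne_oldTail := by grind
      head_ne_vertex := by grind
      arc_oldHead := by grind
      oldTail_arc := by grind
      inj := fun k l hkl h => n₁ (m₁ c hcQ ⟨k, l, hkl, h⟩)
      head_inj := fun k l hkl h => n₂ (m₂ c hcQ ⟨k, l, hkl, h⟩) }
  have hcard := Finset.card_le_card hcover
  rw [Fintype.card_piFinset] at hcard
  have hpow : (n - (3 * D.card + 20)) ^ 4 ≤ ∏ k, (Q k).card := by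
    have := Finset.prod_le_prod' (s := (Finset.univ : Finset (Fin 4)))
      (f := fun _ => n - (3 * D.card + 20)) (g := fun k => (Q k).card) fun k _ => hQ k
    simpa using this
  have u₁ := Finset.card_union_le (goodShifts H y z t) B₁
  have u₂ := Finset.card_union_le (goodShifts H y z t ∪ B₁) B₂
  omega

/-- The members of `Q̂_D` with exactly `s` distinguishable bridges. -/
def bridgeLevel (D : Finset (Fin n)) (y z : Fin n) (P : Fin 6 → Finset (Fin n)) (s : ℕ) :
    Finset (GD n D) :=
  Finset.univ.filter fun H => InQhat H y z P ∧ distBridgeCount H y z P = s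

lemma IsTwist.mem_bridgeLevel {s : ℕ} (hH' : IsTwist H y z t c H') (hyz : y ≠ z)
    (hP : ∀ i j, i ≠ j → Disjoint (P i) (P j))
    (ht : IsGoodTuple H y z P t) (hc : IsGoodShift H y z t c)
    (hs : s + 1 ≤ n * D.card) (hH : H ∈ bridgeLevel D y z P s) :
    H' ∈ bridgeLevel D y z P (s + 1) := by
  have hinj : Function.Injective t := fun i j h => slot_eq_of_mem hP ht.mem ht.mem h
  obtain ⟨⟨-, hE⟩, hr⟩ := (Finset.mem_filter.1 hH).2
  have hr' : distBridgeCount H' y z P = s + 1 := by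
    rw [hH'.distBridgeCount_eq hyz hP ht hc, hr]
  refine Finset.mem_filter.2 ⟨Finset.mem_univ _, ⟨hr'.trans_le hs, fun A₁ A₂ h₁ h₂ => ?_⟩, hr'⟩
  have h := hE A₁ A₂ h₁ h₂
  have h' : (eArcs H' A₁ A₂ : ℝ) ≤ eArcs H A₁ A₂ + 12 := by
    exact_mod_cast hH'.eArcs_le hinj ht hc A₁ A₂
  rw [hr] at h
  rw [hr']
  push_cast
  linarith

lemma card_bridgeLevel_mul_le {s : ℕ} (hyz : y ≠ z)
    (hP : ∀ i j, i ≠ j → Disjoint (P i) (P j)) (hs : s + 1 ≤ n * D.card) {δ₁ δ₂ : ℝ}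
    (hδ₂ : 0 ≤ δ₂)
    (h₁ : ∀ H ∈ bridgeLevel D y z P s, δ₁ ≤ (goodTuples H y z P).card)
    (h₂ : ∀ (H : GD n D) (t), δ₂ ≤ (goodShifts H y z t).card) :
    ((bridgeLevel D y z P s).card : ℝ) * (δ₁ * δ₂) ≤
      (bridgeLevel D y z P (s + 1)).card * ((s + 1) * (n : ℝ) ^ 8) := by
  let X := (bridgeLevel D y z P s).sigma fun H =>
    (goodTuples H y z P).sigma fun t => goodShifts H y z t
  let Y := (bridgeLevel D y z P (s + 1)).sigma fun H' =>
    (Finset.univ.filter fun w => IsDistinguishableBridge H' y z P w) ×ˢ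
      (Finset.univ : Finset ((Fin 4 → Fin n) × (Fin 4 → Fin n)))
  have hX : ((bridgeLevel D y z P s).card : ℝ) * (δ₁ * δ₂) ≤ X.card := by
    rw [Finset.card_sigma, Nat.cast_sum, ← nsmul_eq_mul]
    refine Finset.card_nsmul_le_sum _ _ _ fun H hH => ?_
    rw [Finset.card_sigma, Nat.cast_sum]
    refine (mul_le_mul_of_nonneg_right (h₁ H hH) hδ₂).trans ?_
    rw [← nsmul_eq_mul]
    exact Finset.card_nsmul_le_sum _ _ _ fun t _ => h₂ H t
  have hY : Y.card = (bridgeLevel D y z P (s + 1)).card * ((s + 1) * n ^ 8) := by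
    rw [Finset.card_sigma]
    refine Finset.sum_const_nat fun H' hH' => ?_
    have hr := (Finset.mem_filter.1 hH').2.2
    rw [distBridgeCount, Nat.card_eq_fintype_card, Fintype.card_subtype] at hr
    rw [Finset.card_product, hr, Finset.card_univ, Fintype.card_prod, Fintype.card_fun,
      Fintype.card_fin, Fintype.card_fin, ← pow_add]
  have hex : ∀ x : (_ : GD n D) × (_ : Fin 6 → {d : Fin n // d ∈ D}) × (Fin 4 → Fin n),
      ∃ H', x ∈ X → IsTwist x.1 y z x.2.1 x.2.2 H' := by
    intro x
    by_cases hx : x ∈ X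
    · obtain ⟨ht, hc⟩ := Finset.mem_sigma.1 (Finset.mem_sigma.1 hx).2
      have ht := (Finset.mem_filter.1 ht).2
      obtain ⟨H', hH'⟩ := exists_isTwist ht
        (fun i j h => slot_eq_of_mem hP ht.mem ht.mem h) (Finset.mem_filter.1 hc).2
      exact ⟨H', fun _ => hH'⟩
    · exact ⟨x.1, fun h => absurd h hx⟩
  choose f hf using hex
  have hXY : X.card ≤ Y.card := by
    refine Finset.card_le_card_of_injOn (fun x =>
      ⟨f x, tupleVerts x.1 y z x.2.1, oldTail x.1 y z x.2.1, x.2.2⟩) ?_ ?_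
    · rintro ⟨H, t, c⟩ hx
      have hT := hf _ hx
      obtain ⟨hH, hx⟩ := Finset.mem_sigma.1 hx
      obtain ⟨ht, hc⟩ := Finset.mem_sigma.1 hx
      have ht := (Finset.mem_filter.1 ht).2
      have hc := (Finset.mem_filter.1 hc).2
      refine Finset.mem_sigma.2 ⟨hT.mem_bridgeLevel hyz hP ht hc hs hH, Finset.mem_product.2
        ⟨Finset.mem_filter.2 ⟨Finset.mem_univ _, ?_⟩, Finset.mem_univ _⟩⟩
      exact (hT.isDistinguishableBridge_iff hyz hP ht hc _).2 (Or.inr rfl)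
    · rintro ⟨H₁, t₁, c₁⟩ hx₁ ⟨H₂, t₂, c₂⟩ hx₂ h
      have hT₁ := hf _ hx₁
      have hT₂ := hf _ hx₂
      obtain ⟨-, hx₁⟩ := Finset.mem_sigma.1 hx₁
      obtain ⟨-, hx₂⟩ := Finset.mem_sigma.1 hx₂
      obtain ⟨ht₁, hc₁⟩ := Finset.mem_sigma.1 hx₁
      obtain ⟨ht₂, hc₂⟩ := Finset.mem_sigma.1 hx₂
      have ht₁ := (Finset.mem_filter.1 ht₁).2
      have ht₂ := (Finset.mem_filter.1 ht₂).2
      have hs₁ := hT₁.slotVertex_eq ht₁ (fun i j h => slot_eq_of_mem hP ht₁.mem ht₁.mem h)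
        (Finset.mem_filter.1 hc₁).2
      have hs₂ := hT₂.slotVertex_eq ht₂ (fun i j h => slot_eq_of_mem hP ht₂.mem ht₂.mem h)
        (Finset.mem_filter.1 hc₂).2
      simp only [Sigma.mk.injEq, heq_eq_eq, Prod.mk.injEq] at h
      obtain ⟨hf', hw, ho, rfl⟩ := h
      rw [← hf'] at hT₂ hs₂
      obtain ⟨rfl, rfl⟩ := hT₁.eq_of_eq hT₂ hs₁ hs₂ hw ho
      rfl
  refine hX.trans ?_
  have := hXY.trans_eq hY
  exact_mod_cast this

lemma IsEquitableSixPartition.card_bounds (h : IsEquitableSixPartition D P) (j : Fin 6) :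
    D.card / 6 ≤ (P j).card ∧ (P j).card ≤ D.card / 6 + 1 := by
  obtain ⟨-, hdisj, hU, heq⟩ := h
  have hsum : ∑ i, (P i).card = D.card := by
    rw [← hU, Finset.card_biUnion fun i _ j _ hij => hdisj i j hij]
  rw [← Finset.add_sum_erase _ _ (Finset.mem_univ j)] at hsum
  have hcard : (Finset.univ.erase j).card = 5 := by simp
  have hle := Finset.sum_le_card_nsmul (Finset.univ.erase j) (fun i => (P i).card)
    ((P j).card + 1) fun i _ => heq i j
  have hge := Finset.card_nsmul_le_sum (Finset.univ.erase j) (fun i => (P i).card + 1)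
    (P j).card fun i _ => heq j i
  rw [Finset.sum_add_distrib, Finset.sum_const] at hge
  rw [hcard, smul_eq_mul] at hle hge
  rw [smul_eq_mul] at hge
  omega

lemma half_pow_le_card_goodTuples (hP : IsEquitableSixPartition D P) {q : ℕ}
    (hq : D.card / 6 = q) (hq₀ : 10 ^ 5 ≤ q)
    (hE : ∀ A₁ A₂ : Finset (Fin n), A₁.card = D.card → A₂.card = D.card →
      10 ^ 6 * eArcs H A₁ A₂ ≤ 3 * D.card ^ 2) :
    (q : ℝ) ^ 6 / 2 ≤ (goodTuples H y z P).card := by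
  have hb := hP.card_bounds
  rw [hq] at hb
  have key := prod_card_le_goodTuples H y z P hP.1 (K := q + 1) (E := 3 * D.card ^ 2 / 10 ^ 6)
    (fun j => (hb j).2) fun A₁ A₂ h₁ h₂ =>
      (Nat.le_div_iff_mul_le (by norm_num)).2 (by linarith [hE A₁ A₂ h₁ h₂])
  have hpow : q ^ 6 ≤ ∏ j, (P j).card := by
    have := Finset.prod_le_prod' (s := (Finset.univ : Finset (Fin 6)))
      (f := fun _ => q) (g := fun j => (P j).card) fun j _ => (hb j).1
    simpa using this
  have hEk : 10 ^ 6 * (3 * D.card ^ 2 / 10 ^ 6) ≤ 3 * D.card ^ 2 := Nat.mul_div_le _ _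
  set E := 3 * D.card ^ 2 / 10 ^ 6
  have hk : D.card ≤ 6 * (q + 1) := by omega
  have hEq : 10 ^ 6 * E ≤ 108 * (q + 1) ^ 2 := by
    have : D.card ^ 2 ≤ (6 * (q + 1)) ^ 2 := Nat.pow_le_pow_left hk 2
    linarith
  have key' : (q : ℝ) ^ 6 ≤ (goodTuples H y z P).card + 58 * ((q + 1) * (q + 1) ^ 4) +
      14 * (E * (q + 1) ^ 4) := by exact_mod_cast hpow.trans key
  have hEq' : (10 : ℝ) ^ 6 * E ≤ 108 * ((q : ℝ) + 1) ^ 2 := by exact_mod_cast hEq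
  have hq' : (10 : ℝ) ^ 5 ≤ q := by exact_mod_cast hq₀
  have hq1 : (q : ℝ) + 1 ≤ 1.1 * q := by linarith
  have hp : ∀ m : ℕ, ((q : ℝ) + 1) ^ m ≤ 1.1 ^ m * (q : ℝ) ^ m := fun m => by
    rw [← mul_pow]
    gcongr
  have e1 : 14 * ((E : ℝ) * (q + 1) ^ 4) ≤ 14 * (108 / 10 ^ 6 * (1.1 ^ 6 * (q : ℝ) ^ 6)) := by
    have : (E : ℝ) * (q + 1) ^ 4 ≤ (108 / 10 ^ 6 * ((q : ℝ) + 1) ^ 2) * (q + 1) ^ 4 := by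
      gcongr
      linarith
    have h6 := hp 6
    have : (108 / 10 ^ 6 * ((q : ℝ) + 1) ^ 2) * (q + 1) ^ 4 = 108 / 10 ^ 6 * (q + 1) ^ 6 := by ring
    linarith
  have e2 : ((q : ℝ) + 1) * (q + 1) ^ 4 ≤ 1.1 ^ 5 * ((q : ℝ) ^ 6 / 10 ^ 5) := by
    have h5 := hp 5
    have h56 : (10 : ℝ) ^ 5 * (q : ℝ) ^ 5 ≤ q ^ 6 := by
      rw [pow_succ' (q : ℝ) 5]
      gcongr
    rw [← pow_succ']
    norm_num at h5 h56 ⊢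
    linarith
  have e3 : (0 : ℝ) ≤ (q : ℝ) ^ 6 := by positivity
  norm_num at e1 e2 key' ⊢
  linarith

lemma pow_div_le_card_goodShifts (hn : n = 10 ^ 6 * D.card) (hn₀ : 10 ^ 6 ≤ n)
    (H : GD n D) (t : Fin 6 → {d : Fin n // d ∈ D}) :
    (n : ℝ) ^ 4 / 32 ≤ (goodShifts H y z t).card := by
  have key := pow_le_goodShifts H y z t
  have hle : ((n : ℝ) / 2) ≤ ((n - (3 * D.card + 20) : ℕ) : ℝ) := by
    have : n ≤ 2 * (n - (3 * D.card + 20)) := by omega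
    have : (n : ℝ) ≤ 2 * ((n - (3 * D.card + 20) : ℕ) : ℝ) := by exact_mod_cast this
    linarith
  have key' : ((n - (3 * D.card + 20) : ℕ) : ℝ) ^ 4 ≤
      (goodShifts H y z t).card + 24 * (n * (n : ℝ) ^ 2) := by exact_mod_cast key
  have hpow := pow_le_pow_left₀ (by positivity) hle 4
  have hn' : (10 : ℝ) ^ 6 ≤ n := by exact_mod_cast hn₀
  have h34 : (10 : ℝ) ^ 6 * (n : ℝ) ^ 3 ≤ n ^ 4 := by
    rw [pow_succ' (n : ℝ) 3]
    gcongr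
  have h3 : (0 : ℝ) ≤ (n : ℝ) ^ 3 := by positivity
  ring_nf at key' hpow h34 ⊢
  linarith

lemma two_mul_card_bridgeLevel_le {s : ℕ} (hn : n = 10 ^ 6 * D.card) (hn₀ : 10 ^ 13 ≤ n)
    (hyz : y ≠ z) (hP : IsEquitableSixPartition D P) (hs : 10 ^ 50 * (s + 1) ≤ 2 * n ^ 2) :
    2 * (bridgeLevel D y z P s).card ≤ (bridgeLevel D y z P (s + 1)).card := by
  have hsR : (10 : ℝ) ^ 50 * (s + 1) ≤ 2 * (n : ℝ) ^ 2 := by exact_mod_cast hs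
  have hnR : (n : ℝ) = 10 ^ 6 * D.card := by exact_mod_cast hn
  have hk₀ : 0 < D.card := by omega
  have hkR : (0 : ℝ) < D.card := by exact_mod_cast hk₀
  have hs' : s + 1 ≤ n * D.card := by
    have : n ^ 2 = 10 ^ 6 * (n * D.card) := by
      conv_lhs => rw [pow_two]
      conv_lhs => rhs; rw [hn]
      ring
    omega
  set q := D.card / 6 with hq
  have hq₀ : 10 ^ 5 ≤ q := by omega
  have h₁ : ∀ H ∈ bridgeLevel D y z P s, (q : ℝ) ^ 6 / 2 ≤ (goodTuples H y z P).card := by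
    intro H hH
    obtain ⟨⟨-, hE⟩, hr⟩ := (Finset.mem_filter.1 hH).2
    refine half_pow_le_card_goodTuples hP hq.symm hq₀ fun A₁ A₂ hA₁ hA₂ => ?_
    have h := hE A₁ A₂ hA₁ hA₂
    rw [hr] at h
    have hdiv : 2 * (D.card : ℝ) ^ 3 / n = 2 * D.card ^ 2 / 10 ^ 6 := by
      rw [hnR]
      field_simp
    rw [hdiv] at h
    have hn2 : (n : ℝ) ^ 2 = 10 ^ 12 * (D.card : ℝ) ^ 2 := by rw [hnR]; ring
    rw [hn2] at hsR
    have hk2 : (0 : ℝ) ≤ (D.card : ℝ) ^ 2 := by positivity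
    have : (10 : ℝ) ^ 6 * eArcs H A₁ A₂ ≤ 3 * D.card ^ 2 := by
      norm_num at hsR h ⊢
      linarith
    exact_mod_cast this
  have h := card_bridgeLevel_mul_le hyz hP.2.1 hs' (by positivity) h₁ fun H t =>
    pow_div_le_card_goodShifts hn (by omega) H t
  have hqk : (D.card : ℝ) ≤ 7 * q := by
    have : D.card ≤ 7 * q := by omega
    exact_mod_cast this
  have hq6 : (D.card : ℝ) ^ 6 ≤ 7 ^ 6 * (q : ℝ) ^ 6 := by
    rw [← mul_pow]
    gcongr
  have hbig : 2 * ((s + 1) * (n : ℝ) ^ 8) ≤ (q : ℝ) ^ 6 / 2 * ((n : ℝ) ^ 4 / 32) := by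
    have e1 : (n : ℝ) ^ 6 = 10 ^ 36 * (D.card : ℝ) ^ 6 := by rw [hnR]; ring
    have e2 : (n : ℝ) ^ 6 ≤ 10 ^ 36 * (7 ^ 6 * (q : ℝ) ^ 6) := by
      rw [e1]
      gcongr
    have e3 : (s : ℝ) + 1 ≤ 2 * n ^ 2 / 10 ^ 50 := by
      rw [le_div_iff₀ (by positivity)]
      linarith
    calc 2 * ((s + 1) * (n : ℝ) ^ 8) ≤ 2 * (2 * n ^ 2 / 10 ^ 50 * (n : ℝ) ^ 8) := by gcongr
      _ = 4 / 10 ^ 50 * (n : ℝ) ^ 4 * n ^ 6 := by ring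
      _ ≤ 4 / 10 ^ 50 * (n : ℝ) ^ 4 * (10 ^ 36 * (7 ^ 6 * (q : ℝ) ^ 6)) := by gcongr
      _ = (4 / 10 ^ 50 * 10 ^ 36 * 7 ^ 6) * ((n : ℝ) ^ 4 * (q : ℝ) ^ 6) := by ring
      _ ≤ (1 / 64) * ((n : ℝ) ^ 4 * (q : ℝ) ^ 6) := by
        gcongr
        norm_num
      _ = (q : ℝ) ^ 6 / 2 * ((n : ℝ) ^ 4 / 32) := by ring
  have hnpos : (0 : ℝ) < n := by rw [hnR]; positivity
  have hpos : (0 : ℝ) < (s + 1) * (n : ℝ) ^ 8 := by positivity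
  have hfin : 2 * ((bridgeLevel D y z P s).card : ℝ) * ((s + 1) * (n : ℝ) ^ 8) ≤
      (bridgeLevel D y z P (s + 1)).card * ((s + 1) * (n : ℝ) ^ 8) := by
    refine le_trans ?_ h
    rw [mul_comm 2, mul_assoc]
    gcongr
  exact_mod_cast le_of_mul_le_mul_right hfin hpos

lemma two_pow_mul_card_bridgeLevel_le {N : ℕ}
    (h : ∀ s < N, 2 * (bridgeLevel D y z P s).card ≤ (bridgeLevel D y z P (s + 1)).card)
    {s m : ℕ} (hm : s + m ≤ N) :
    2 ^ m * (bridgeLevel D y z P s).card ≤ (bridgeLevel D y z P (s + m)).card := by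
  induction m with
  | zero => simp
  | succ m ih =>
    have h₁ := ih (by omega)
    have h₂ := h (s + m) (by omega)
    rw [pow_succ', mul_assoc]
    exact (Nat.mul_le_mul_left 2 h₁).trans h₂

lemma sum_card_bridgeLevel (S : Finset ℕ) :
    ∑ s ∈ S, (bridgeLevel D y z P s).card =
      (Finset.univ.filter fun H : GD n D => InQhat H y z P ∧ distBridgeCount H y z P ∈ S).card := by
  rw [Finset.card_eq_sum_card_fiberwise (f := fun H => distBridgeCount H y z P) (t := S)
    fun H hH => (Finset.mem_filter.1 hH).2.2]
  refine Finset.sum_congr rfl fun s hs => congrArg Finset.card ?_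
  ext H
  simp only [bridgeLevel, Finset.mem_filter, Finset.mem_univ, true_and]
  constructor
  · rintro ⟨h₁, rfl⟩
    exact ⟨⟨h₁, hs⟩, rfl⟩
  · rintro ⟨⟨h₁, -⟩, h₂⟩
    exact ⟨h₁, h₂⟩

lemma two_pow_mul_card_le {T : ℕ}
    (h : ∀ s < 2 * T, 2 * (bridgeLevel D y z P s).card ≤ (bridgeLevel D y z P (s + 1)).card) :
    2 ^ T * Nat.card {H : GD n D // InQhat H y z P ∧ distBridgeCount H y z P ≤ T} ≤
      Nat.card {H : GD n D // InQhat H y z P} := by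
  have e₁ : Nat.card {H : GD n D // InQhat H y z P ∧ distBridgeCount H y z P ≤ T} =
      ∑ s ∈ Finset.range (T + 1), (bridgeLevel D y z P s).card := by
    rw [sum_card_bridgeLevel, Nat.card_eq_fintype_card, Fintype.card_subtype]
    simp only [Finset.mem_range, Nat.lt_succ_iff]
  rw [e₁, Finset.mul_sum]
  calc ∑ s ∈ Finset.range (T + 1), 2 ^ T * (bridgeLevel D y z P s).card
      ≤ ∑ s ∈ Finset.range (T + 1), (bridgeLevel D y z P (s + T)).card := by
        refine Finset.sum_le_sum fun s hs => two_pow_mul_card_bridgeLevel_le h ?_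
        have := Finset.mem_range.1 hs
        omega
    _ = ∑ s ∈ (Finset.range (T + 1)).map (addRightEmbedding T), (bridgeLevel D y z P s).card := by
        rw [Finset.sum_map]
        rfl
    _ ≤ Nat.card {H : GD n D // InQhat H y z P} := by
        rw [sum_card_bridgeLevel, Nat.card_eq_fintype_card, Fintype.card_subtype]
        exact Finset.card_le_card fun H hH =>
          Finset.mem_filter.2 ⟨Finset.mem_univ _, (Finset.mem_filter.1 hH).2.1⟩

end Twist

/-- For `|D| = n/10⁶`, distinct `y, z`, an equitable six-partition `𝒫`
of `D`, and a uniformly random `H ∈ 𝒢_D`,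
`P[r_{(y,z,𝒫)}(H) ≤ n²/10⁵⁰ | H ∈ Q̂_D] ≤ exp(-a n²)`. -/
theorem statement_8 :
    ∃ a : ℝ, 0 < a ∧ ∃ n₀ : ℕ, ∀ n : ℕ, n₀ ≤ n → 10 ^ 6 ∣ n →
      ∀ D : Finset (Fin n), D.card = n / 10 ^ 6 →
      ∀ y z : Fin n, y ≠ z →
      ∀ P : Fin 6 → Finset (Fin n), IsEquitableSixPartition D P →
        (Nat.card {H : GD n D // InQhat H y z P ∧
            (distBridgeCount H y z P : ℝ) ≤ (n : ℝ) ^ 2 / 10 ^ 50} : ℝ) ≤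
          Real.exp (-(a * (n : ℝ) ^ 2)) *
            (Nat.card {H : GD n D // InQhat H y z P} : ℝ) := by
  refine ⟨1 / 10 ^ 51, by positivity, 10 ^ 26, fun n hn hdvd D hD y z hyz P hP => ?_⟩
  have hnk : n = 10 ^ 6 * D.card := by rw [hD, Nat.mul_div_cancel' hdvd]
  set T : ℕ := n ^ 2 / 10 ^ 50 with hT
  have hTle : T * 10 ^ 50 ≤ n ^ 2 := Nat.div_mul_le_self _ _
  have hTlt : n ^ 2 < (T + 1) * 10 ^ 50 := by
    have := Nat.lt_div_mul_add (a := n ^ 2) (b := 10 ^ 50) (by norm_num)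
    rw [← hT] at this
    linarith
  have key := two_pow_mul_card_le (D := D) (y := y) (z := z) (P := P) (T := T) fun s hs =>
    two_mul_card_bridgeLevel_le hnk (by omega) hyz hP (by omega)
  have hcond : ∀ H : GD n D, (distBridgeCount H y z P : ℝ) ≤ (n : ℝ) ^ 2 / 10 ^ 50 ↔
      distBridgeCount H y z P ≤ T := by
    intro H
    rw [le_div_iff₀ (by positivity), hT, Nat.le_div_iff_mul_le (by norm_num)]
    exact_mod_cast Iff.rfl
  simp only [hcond]
  have hexp : Real.exp (1 / 10 ^ 51 * (n : ℝ) ^ 2) ≤ 2 ^ T := by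
    rw [← Real.exp_log (by positivity : (0 : ℝ) < 2 ^ T), Real.log_pow]
    refine Real.exp_le_exp.2 ?_
    have h1 : (n : ℝ) ^ 2 ≤ (T + 1) * 10 ^ 50 := by exact_mod_cast hTlt.le
    have hlog := Real.log_two_gt_d9
    have hT1 : (1 : ℝ) ≤ T := by
      have : 1 ≤ T := by
        rw [hT, Nat.le_div_iff_mul_le (by norm_num)]
        calc 1 * 10 ^ 50 ≤ (10 ^ 26) ^ 2 := by norm_num
          _ ≤ n ^ 2 := Nat.pow_le_pow_left hn 2
      exact_mod_cast this
    have h2 : (T : ℝ) * 0.6 ≤ T * Real.log 2 := by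
      gcongr
      linarith
    norm_num at h1 h2 ⊢
    linarith
  have key' : (2 : ℝ) ^ T *
      (Nat.card {H : GD n D // InQhat H y z P ∧ distBridgeCount H y z P ≤ T} : ℝ) ≤
      Nat.card {H : GD n D // InQhat H y z P} := by exact_mod_cast key
  rw [Real.exp_neg, ← div_eq_inv_mul, le_div_iff₀' (Real.exp_pos _)]
  exact (mul_le_mul_of_nonneg_right hexp (Nat.cast_nonneg _)).trans key'

end RandomLatin
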